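/- For n ≥ 2 and every X ∈ Y_{d,n}^B, tr_{n−1}(tr_n(X g_{n−1})) = tr_{n−1}(tr_n(g_{n−1} X)). -/

import Mathlib

set_option maxHeartbeats 1000000
set_option synthInstance.maxHeartbeats 400000

noncomputable section

/-- The field `L = ℂ(u,v,z)` of rational functions in three indeterminates over `ℂ`. -/
abbrev Kf : Type := FractionRing (MvPolynomial (Fin 3) ℂ)

/-- The indeterminate `u`. -/
def uu : Kf := algebraMap (MvPolynomial (Fin 3) ℂ) Kf (MvPolynomial.X 0)

/-- The indeterminate `v`. -/
def vv : Kf := algebraMap (MvPolynomial (Fin 3) ℂ) Kf (MvPolynomial.X 1)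

/-- The indeterminate `z`. -/
def zz : Kf := algebraMap (MvPolynomial (Fin 3) ℂ) Kf (MvPolynomial.X 2)

/-- Generators of the framization of the Hecke algebra of type B on `n` strands:
`b` is the generator `b₁`, `g i` is the braiding generator `g_{i+1}` (`i : Fin (n-1)`),
and `t j` is the framing generator `t_{j+1}` (`j : Fin n`). -/
inductive Gen (n : ℕ) : Type
  | b : Gen n
  | g : Fin (n - 1) → Gen n
  | t : Fin n → Gen n

/-- The free algebra on the generators. -/
abbrev FA (n : ℕ) : Type := FreeAlgebra Kf (Gen n)

/-- The generator `b₁` in the free algebra. -/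
def Bb (n : ℕ) : FA n := FreeAlgebra.ι Kf Gen.b

/-- The generator `g_i` (for `1 ≤ i ≤ n-1`) in the free algebra; junk value `1` out of range. -/
def Gg (n i : ℕ) : FA n :=
  if h : 1 ≤ i ∧ i ≤ n - 1 then FreeAlgebra.ι Kf (Gen.g ⟨i - 1, by omega⟩) else 1

/-- The generator `t_j` (for `1 ≤ j ≤ n`) in the free algebra; junk value `1` out of range. -/
def Tt (n j : ℕ) : FA n :=
  if h : 1 ≤ j ∧ j ≤ n then FreeAlgebra.ι Kf (Gen.t ⟨j - 1, by omega⟩) else 1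

/-- The element `e_i = (1/d) ∑_{m=0}^{d-1} t_i^m t_{i+1}^{d-m}` in the free algebra. -/
def eF (d n i : ℕ) : FA n :=
  (d : Kf)⁻¹ • ∑ m ∈ Finset.range d, Tt n i ^ m * Tt n (i + 1) ^ (d - m)

/-- The element `f₁ = (1/d) ∑_{m=0}^{d-1} t₁^m` in the free algebra. -/
def fF (d n : ℕ) : FA n :=
  (d : Kf)⁻¹ • ∑ m ∈ Finset.range d, Tt n 1 ^ m

/-- The action of the simple transposition `s_i` on indices: swaps `i` and `i+1`. -/
def sAct (i j : ℕ) : ℕ := if j = i then i + 1 else if j = i + 1 then i else j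

/-- The defining relations of the framization `Y_{d,n}^B` of the Hecke algebra of type B. -/
inductive YBrel (d n : ℕ) : FA n → FA n → Prop
  | gg : ∀ i j : ℕ, 1 ≤ i → i ≤ n - 1 → 1 ≤ j → j ≤ n - 1 → (i + 1 < j ∨ j + 1 < i) →
      YBrel d n (Gg n i * Gg n j) (Gg n j * Gg n i)
  | braid : ∀ i : ℕ, 1 ≤ i → i ≤ n - 2 →
      YBrel d n (Gg n i * Gg n (i + 1) * Gg n i) (Gg n (i + 1) * Gg n i * Gg n (i + 1))
  | bg : ∀ i : ℕ, 2 ≤ i → i ≤ n - 1 → YBrel d n (Bb n * Gg n i) (Gg n i * Bb n)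
  | bgbg : YBrel d n (Bb n * Gg n 1 * Bb n * Gg n 1) (Gg n 1 * Bb n * Gg n 1 * Bb n)
  | tt : ∀ i j : ℕ, 1 ≤ i → i ≤ n → 1 ≤ j → j ≤ n →
      YBrel d n (Tt n i * Tt n j) (Tt n j * Tt n i)
  | tg : ∀ i j : ℕ, 1 ≤ i → i ≤ n - 1 → 1 ≤ j → j ≤ n →
      YBrel d n (Tt n j * Gg n i) (Gg n i * Tt n (sAct i j))
  | tb : ∀ i : ℕ, 1 ≤ i → i ≤ n → YBrel d n (Tt n i * Bb n) (Bb n * Tt n i)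
  | td : ∀ i : ℕ, 1 ≤ i → i ≤ n → YBrel d n (Tt n i ^ d) 1
  | gsq : ∀ i : ℕ, 1 ≤ i → i ≤ n - 1 →
      YBrel d n (Gg n i ^ 2) (1 + (uu - uu⁻¹) • (eF d n i * Gg n i))
  | bsq : YBrel d n (Bb n ^ 2) (1 + (vv - vv⁻¹) • (fF d n * Bb n))

/-- The framization of the Hecke algebra of type B, `Y_{d,n}^B`. -/
abbrev YB (d n : ℕ) : Type := RingQuot (YBrel d n)

instance (d n : ℕ) : Ring (YB d n) := RingQuot.instRing (YBrel d n)

instance (d n : ℕ) : Algebra Kf (YB d n) := RingQuot.instAlgebra _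

instance (d n : ℕ) : Module Kf (YB d n) := Algebra.toModule

/-- The canonical projection from the free algebra onto `Y_{d,n}^B`. -/
def mkY (d n : ℕ) : FA n →ₐ[Kf] YB d n := RingQuot.mkAlgHom Kf (YBrel d n)

/-- The generator `b₁` of `Y_{d,n}^B`. -/
def bY (d n : ℕ) : YB d n := mkY d n (Bb n)

/-- The generator `g_i` of `Y_{d,n}^B`. -/
def gY (d n : ℕ) (i : ℕ) : YB d n := mkY d n (Gg n i)

/-- The generator `t_j` of `Y_{d,n}^B`. -/
def tY (d n : ℕ) (j : ℕ) : YB d n := mkY d n (Tt n j)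

/-- The idempotent `e_i` of `Y_{d,n}^B`. -/
def eY (d n : ℕ) (i : ℕ) : YB d n := mkY d n (eF d n i)

/-- The idempotent `f₁` of `Y_{d,n}^B`. -/
def fY (d n : ℕ) : YB d n := mkY d n (fF d n)

/-- The element `g_i⁻¹ = g_i - (u - u⁻¹) e_i`. -/
def gInv (d n i : ℕ) : YB d n := gY d n i - (uu - uu⁻¹) • eY d n i

/-- The elements `b_k := g_{k-1} ⋯ g_1 b_1 g_1⁻¹ ⋯ g_{k-1}⁻¹` for `2 ≤ k ≤ n`,
defined by `b_k = g_{k-1} b_{k-1} g_{k-1}⁻¹`; with `b_1` the generator `b₁`. -/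
def bk (d n : ℕ) : ℕ → YB d n
  | 0 => 1
  | 1 => bY d n
  | (k + 2) => gY d n (k + 1) * bk d n (k + 1) * gInv d n (k + 1)

/-- The descending product `g_{k-1} g_{k-2} ⋯ g_j`. -/
def gRange (d n j k : ℕ) : YB d n := (((List.range' j (k - j)).reverse).map (gY d n)).prod

/-- The elements `𝔪⁺_{k,j,m}`: `𝔪⁺_{k,k,m} = t_k^m` and
`𝔪⁺_{k,j,m} = g_{k-1} ⋯ g_j t_j^m` for `j < k`. -/
def mPlus (d n k j m : ℕ) : YB d n :=
  if j = k then tY d n k ^ m else gRange d n j k * tY d n j ^ m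

/-- The elements `𝔪⁻_{k,j,m}`: `𝔪⁻_{k,k,m} = t_k^m b_k` and
`𝔪⁻_{k,j,m} = g_{k-1} ⋯ g_j b_j t_j^m` for `j < k`. -/
def mMinus (d n k j m : ℕ) : YB d n :=
  if j = k then tY d n k ^ m * bk d n k else gRange d n j k * (bk d n j * tY d n j ^ m)

/-- The subsets `M_{d,k}` of `Y_{d,n}^B`:
`M_{d,1} = {t₁^m, t₁^m b₁}` and `M_{d,k} = {t_k^m, t_k^m b_k, g_{k-1} x : x ∈ M_{d,k-1}}`. -/
def Mset (d n : ℕ) : ℕ → Set (YB d n)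
  | 0 => {1}
  | 1 => {x | ∃ m ≤ d - 1, x = tY d n 1 ^ m ∨ x = tY d n 1 ^ m * bY d n}
  | (k + 2) => {x |
      (∃ m ≤ d - 1, x = tY d n (k + 2) ^ m ∨ x = tY d n (k + 2) ^ m * bk d n (k + 2)) ∨
      ∃ y ∈ Mset d n (k + 1), x = gY d n (k + 1) * y}

/-- The set `𝖢_n` of all products `𝔪_1 𝔪_2 ⋯ 𝔪_n` with `𝔪_i ∈ M_{d,i}`. -/
def Cset (d n : ℕ) : Set (YB d n) :=
  {x | ∃ f : Fin n → YB d n, (∀ i : Fin n, f i ∈ Mset d n (i.val + 1)) ∧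
    x = (List.ofFn f).prod}

/-- Characterization of the natural inclusion `Y_{d,n}^B ⊆ Y_{d,n+1}^B`:
the algebra map sending generators to the generators of the same name. -/
def IsIncl (d n : ℕ) (inc : YB d n →ₐ[Kf] YB d (n + 1)) : Prop :=
  inc (bY d n) = bY d (n + 1) ∧
  (∀ i, 1 ≤ i → i ≤ n - 1 → inc (gY d n i) = gY d (n + 1) i) ∧
  (∀ j, 1 ≤ j → j ≤ n → inc (tY d n j) = tY d (n + 1) j)

/-- Characterization of the relative trace `tr_{n+1} : Y_{d,n+1}^B → Y_{d,n}^B`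
(with respect to trace parameters `x`, `y`): it is the `L`-linear map defined on the
basis `𝖢_{n+1}` by `tr(w t_{n+1}^m) = x_m w`, `tr(w b_{n+1} t_{n+1}^m) = y_m w`, and
`tr(w 𝔪^±_{n+1,k,m}) = z (w 𝔪^±_{n,k,m})` for `k < n+1`, where `w ∈ 𝖢_n`. -/
def IsRelTrace (d : ℕ) (x y : ZMod d → Kf) (n : ℕ)
    (inc : YB d n →ₐ[Kf] YB d (n + 1)) (tr : YB d (n + 1) →ₗ[Kf] YB d n) : Prop :=
  ∀ w ∈ Cset d n, ∀ m : ℕ, m ≤ d - 1 →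
    (tr (inc w * tY d (n + 1) (n + 1) ^ m) = x (m : ZMod d) • w) ∧
    (tr (inc w * (bk d (n + 1) (n + 1) * tY d (n + 1) (n + 1) ^ m)) = y (m : ZMod d) • w) ∧
    (∀ k, 1 ≤ k → k ≤ n →
      tr (inc w * mPlus d (n + 1) (n + 1) k m) = zz • (w * mPlus d n n k m) ∧
      tr (inc w * mMinus d (n + 1) (n + 1) k m) = zz • (w * mMinus d n n k m))

/-- Characterization of the trace `tr_1 : Y_{d,1}^B → L`:
`tr_1(t₁^a) = x_a` and `tr_1(b₁ t₁^a) = y_a`. -/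
def IsTr1 (d : ℕ) (x y : ZMod d → Kf) (tr1 : YB d 1 →ₗ[Kf] Kf) : Prop :=
  ∀ a : ℕ, a ≤ d - 1 →
    tr1 (tY d 1 1 ^ a) = x (a : ZMod d) ∧ tr1 (bY d 1 * tY d 1 1 ^ a) = y (a : ZMod d)

/-- The Markov trace tower `Tr_{m+1} = tr_1 ∘ tr_2 ∘ ⋯ ∘ tr_{m+1} : Y_{d,m+1}^B → L`,
built from the relative traces (`tr k` here is the relative trace
`tr_{k+2} : Y_{d,k+2}^B → Y_{d,k+1}^B`). -/
def TrT (d : ℕ) (tr1 : YB d 1 →ₗ[Kf] Kf)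
    (tr : (k : ℕ) → (YB d (k + 2) →ₗ[Kf] YB d (k + 1))) :
    (m : ℕ) → (YB d (m + 1) →ₗ[Kf] Kf)
  | 0 => tr1
  | (m + 1) => (TrT d tr1 tr m).comp (tr m)

set_option linter.unusedSectionVars false

section RelativeTrace

variable {K : Type*} [Field K] {d : ℕ} [NeZero d]

/-- The average of a family indexed by `ℤ/d`. -/
def avg (K : Type*) [Field K] {d : ℕ} [NeZero d] {M : Type*} [AddCommGroup M] [Module K M]
    (F : ZMod d → M) : M :=
  (d : K)⁻¹ • ∑ s, F s

section Avg

variable {M N R : Type*} [AddCommGroup M] [Module K M] [AddCommGroup N] [Module K N]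
  [Ring R] [Algebra K R]

lemma map_avg (f : M →ₗ[K] N) (F : ZMod d → M) : f (avg K F) = avg K fun s => f (F s) := by
  simp [avg, map_sum]

lemma mul_avg (a : R) (F : ZMod d → R) : a * avg K F = avg K fun s => a * F s := by
  simp [avg, Finset.mul_sum]

lemma avg_mul (a : R) (F : ZMod d → R) : avg K F * a = avg K fun s => F s * a := by
  simp [avg, Finset.sum_mul]

lemma smul_avg (c : K) (F : ZMod d → M) : c • avg K F = avg K fun s => c • F s := by
  simp [avg, Finset.smul_sum, smul_comm c]

lemma avg_sub (F G : ZMod d → M) : avg K (fun s => F s - G s) = avg K F - avg K G := by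
  simp [avg, Finset.sum_sub_distrib, smul_sub]

lemma avg_equiv (σ : ZMod d ≃ ZMod d) (F : ZMod d → M) :
    avg K (fun s => F (σ s)) = avg K F := by
  simp only [avg, Equiv.sum_comp]

lemma avg_const [CharZero K] (m : M) : avg K (fun _ : ZMod d => m) = m := by
  have : (d : K) ≠ 0 := Nat.cast_ne_zero.2 (NeZero.ne d)
  simp only [avg, Finset.sum_const, Finset.card_univ, ZMod.card, ← Nat.cast_smul_eq_nsmul K,
    smul_smul, inv_mul_cancel₀ this, one_smul]

end Avg

variable {A B : Type*} [Ring A] [Algebra K A] [Ring B] [Algebra K B]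

/-- `t` parametrises the powers of an element of order dividing `d`, `b` is a loop generator,
both attached to the last strand of `B` over `A`, and `tr : B → A` is a bimodule map taking the
prescribed values on `t s` and `b * t s`. -/
structure LoopTrace (x y : ZMod d → K) (i : A →ₐ[K] B) (tr : B →ₗ[K] A) (t : ZMod d → B)
    (b : B) : Prop where
  t_zero : t 0 = 1
  t_add : ∀ r s, t (r + s) = t r * t s
  t_b : ∀ s, t s * b = b * t s
  t_i : ∀ s a, t s * i a = i a * t s
  tr_left : ∀ a X, tr (i a * X) = a * tr X
  tr_right : ∀ X a, tr (X * i a) = tr X * a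
  tr_t : ∀ s, tr (t s) = x s • 1
  tr_b : ∀ s, tr (b * t s) = y s • 1

/-- The idempotent attached to the last two framing generators. -/
def eAvg (i : A →ₐ[K] B) (t' : ZMod d → A) (t : ZMod d → B) : B :=
  avg K fun s => i (t' s) * t (-s)

/-- A `LoopTrace` together with the braiding generator `h` of the last two strands. -/
structure BraidTrace (q z : K) (x y : ZMod d → K) (i : A →ₐ[K] B) (tr : B →ₗ[K] A)
    (t : ZMod d → B) (b : B) (t' : ZMod d → A) (b' : A) (h : B) : Prop
    extends LoopTrace x y i tr t b where
  t'_zero : t' 0 = 1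
  t'_add : ∀ r s, t' (r + s) = t' r * t' s
  t'_b' : ∀ s, t' s * b' = b' * t' s
  h_t' : ∀ s, h * i (t' s) = t s * h
  t'_h : ∀ s, i (t' s) * h = h * t s
  b_h : b * h = h * i b'
  b_t' : ∀ s, b * i (t' s) = i (t' s) * b
  h_sq : h * h = 1 + q • (eAvg i t' t * h)
  h_cancel : ∀ X Y : B, X * h = Y * h → X = Y
  tr_h : ∀ a c, tr (i a * h * i c) = z • (a * c)

namespace LoopTrace

variable {x y : ZMod d → K} {i : A →ₐ[K] B} {tr : B →ₗ[K] A} {t : ZMod d → B} {b : B}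

lemma t_comm (H : LoopTrace x y i tr t b) (r s : ZMod d) : t r * t s = t s * t r := by
  rw [← H.t_add, add_comm, H.t_add]

lemma tr_i_t (H : LoopTrace x y i tr t b) (a : A) (s : ZMod d) :
    tr (i a * t s) = x s • a := by
  simp [H.tr_left, H.tr_t]

lemma tr_i_b (H : LoopTrace x y i tr t b) (a : A) (s : ZMod d) :
    tr (i a * (b * t s)) = y s • a := by
  simp [H.tr_left, H.tr_b]

end LoopTrace

namespace BraidTrace

variable {q z : K} {x y : ZMod d → K} {i : A →ₐ[K] B} {tr : B →ₗ[K] A} {t : ZMod d → B} {b : B}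
  {t' : ZMod d → A} {b' : A} {h : B}

lemma t'_comm (H : BraidTrace q z x y i tr t b t' b' h) (r s : ZMod d) :
    t' r * t' s = t' s * t' r := by
  rw [← H.t'_add, add_comm, H.t'_add]

lemma tr_h_right (H : BraidTrace q z x y i tr t b t' b' h) (c : A) :
    tr (h * i c) = z • c := by
  simpa using H.tr_h 1 c

lemma tr_h_left (H : BraidTrace q z x y i tr t b t' b' h) (a : A) :
    tr (i a * h) = z • a := by
  simpa using H.tr_h a 1

lemma e_b (H : BraidTrace q z x y i tr t b t' b' h) : eAvg i t' t * b = b * eAvg i t' t := by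
  unfold eAvg
  rw [avg_mul, mul_avg]
  congr 1; funext s
  rw [mul_assoc, H.t_b, ← mul_assoc, ← H.b_t', mul_assoc]

lemma e_b' (H : BraidTrace q z x y i tr t b t' b' h) : eAvg i t' t * i b' = i b' * eAvg i t' t := by
  unfold eAvg
  rw [avg_mul, mul_avg]
  congr 1; funext s
  rw [mul_assoc, H.t_i, ← mul_assoc, ← map_mul, H.t'_b', map_mul, mul_assoc]

lemma e_t' (H : BraidTrace q z x y i tr t b t' b' h) (r : ZMod d) :
    eAvg i t' t * i (t' r) = i (t' r) * eAvg i t' t := by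
  unfold eAvg
  rw [avg_mul, mul_avg]
  congr 1; funext s
  rw [mul_assoc, H.t_i, ← mul_assoc, ← map_mul, H.t'_comm, map_mul, mul_assoc]

lemma e_t (H : BraidTrace q z x y i tr t b t' b' h) (r : ZMod d) :
    eAvg i t' t * t r = t r * eAvg i t' t := by
  unfold eAvg
  rw [avg_mul, mul_avg]
  congr 1; funext s
  rw [mul_assoc, ← mul_assoc (t r), H.t_i, mul_assoc, H.t_comm]

lemma t_e (H : BraidTrace q z x y i tr t b t' b' h) (k : ZMod d) :
    t k * eAvg i t' t = avg K fun s => i (t' s) * t (k - s) := by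
  unfold eAvg
  rw [mul_avg]
  congr 1; funext s
  rw [← mul_assoc, H.t_i, mul_assoc, sub_eq_add_neg, H.t_add]

lemma t'_mul_e (H : BraidTrace q z x y i tr t b t' b' h) (k : ZMod d) :
    i (t' k) * eAvg i t' t = t k * eAvg i t' t := by
  rw [H.t_e, ← avg_equiv (Equiv.addRight k)]
  unfold eAvg
  rw [mul_avg]
  congr 1; funext s
  simp only [Equiv.coe_addRight]
  rw [← mul_assoc, ← map_mul, ← H.t'_add, add_comm s k, sub_add_cancel_left]

lemma e_e [CharZero K] (H : BraidTrace q z x y i tr t b t' b' h) :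
    eAvg i t' t * eAvg i t' t = eAvg i t' t := by
  conv_lhs => enter [1]; unfold eAvg
  rw [avg_mul]
  have : ∀ s, i (t' s) * t (-s) * eAvg i t' t = eAvg i t' t := fun s => by
    rw [mul_assoc, ← H.t'_mul_e, ← mul_assoc, ← map_mul, ← H.t'_add, add_neg_cancel, H.t'_zero,
      map_one, one_mul]
  simp only [this, avg_const]

/-- Moving `b` to the left through `h`. -/
lemma h_b (H : BraidTrace q z x y i tr t b t' b' h) :
    h * b = i b' * h + q • (eAvg i t' t * (b - i b')) := by
  apply H.h_cancel
  rw [mul_assoc, H.b_h, ← mul_assoc, H.h_sq, add_mul (i b' * h), mul_assoc (i b') h h, H.h_sq]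
  simp only [mul_sub, sub_mul, mul_add, add_mul, smul_mul_assoc, mul_smul_comm, one_mul, mul_one]
  rw [mul_assoc (eAvg i t' t) b h, H.b_h, ← mul_assoc (i b') (eAvg i t' t) h, ← H.e_b']
  simp only [mul_assoc, smul_sub]
  abel

lemma h_b_t (H : BraidTrace q z x y i tr t b t' b' h) (m : ZMod d) :
    h * (b * t m) = i (b' * t' m) * h + q • (t m * (eAvg i t' t * (b - i b'))) := by
  have h1 : (b - i b') * t m = t m * (b - i b') := by rw [sub_mul, mul_sub, H.t_b, H.t_i]
  rw [← mul_assoc, H.h_b, add_mul, smul_mul_assoc, mul_assoc _ (b - i b') (t m), h1,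
    ← mul_assoc _ (t m),
    H.e_t, mul_assoc (t m), mul_assoc (i b') h, ← H.t'_h, ← mul_assoc, map_mul]

lemma tr_t_e_h [CharZero K] (H : BraidTrace q z x y i tr t b t' b' h) (k : ZMod d) (c : A) :
    tr (t k * (eAvg i t' t * h) * i c) = z • (t' k * c) := by
  have : eAvg i t' t * h * i c = avg K fun s => i (t' s) * h * i (t' (-s) * c) := by
    unfold eAvg
    rw [avg_mul, avg_mul]
    congr 1; funext s
    rw [mul_assoc (i _), ← H.h_t', map_mul]
    simp only [mul_assoc]
  rw [← mul_assoc (t k), ← H.t'_mul_e, mul_assoc (i _), mul_assoc (i _), H.tr_left, this, map_avg]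
  have : ∀ s, tr (i (t' s) * h * i (t' (-s) * c)) = z • c := fun s => by
    rw [H.tr_h, ← mul_assoc, ← H.t'_add, add_neg_cancel, H.t'_zero, one_mul]
  simp only [this, avg_const, mul_smul_comm]

lemma tr_t_h (H : BraidTrace q z x y i tr t b t' b' h) (k : ZMod d) (c : A) :
    tr (t k * h * i c) = z • (t' k * c) := by
  rw [← H.h_t', mul_assoc, ← map_mul, H.tr_h_right]

lemma tr_h_t'_h [CharZero K] (H : BraidTrace q z x y i tr t b t' b' h) (k : ZMod d) :
    tr (h * i (t' k) * h) = x k • 1 + (q * z) • t' k := by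
  have := H.tr_t_e_h k 1
  rw [map_one, mul_one, mul_one] at this
  rw [H.h_t', mul_assoc, H.h_sq, mul_add, mul_one, map_add, H.tr_t, mul_smul_comm, map_smul,
    this, smul_smul]

lemma tr_h_b'_h [CharZero K] (H : BraidTrace q z x y i tr t b t' b' h) (k : ZMod d) :
    tr (h * i (b' * t' k) * h) = y k • 1 + (q * z) • (b' * t' k) := by
  have h1 : h * i (b' * t' k) * h = b * t k + q • (t k * (eAvg i t' t * h) * i b') := by
    rw [map_mul, ← mul_assoc, ← H.b_h, mul_assoc, mul_assoc, H.t'_h, ← mul_assoc h, H.h_sq,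
      add_mul, one_mul, mul_add, smul_mul_assoc, mul_smul_comm]
    congr 2
    rw [mul_assoc _ h, ← H.t'_h, ← mul_assoc (eAvg i t' t), H.e_t', H.t'_mul_e, mul_assoc (t k),
      mul_assoc (t k), mul_assoc _ h, ← H.b_h, ← mul_assoc b, ← H.t_b, ← mul_assoc _ b, H.e_b]
    simp only [mul_assoc]
  rw [h1, map_add, map_smul, H.tr_t_e_h, smul_smul, H.t'_b']
  simpa using H.tr_i_b 1 k

/-- The trace of the correction term in `BraidTrace.h_b`. -/
lemma tr_t_e_b (H : BraidTrace q z x y i tr t b t' b' h) (k : ZMod d) :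
    tr (t k * (eAvg i t' t * (b - i b'))) =
      avg K fun s => y (k - s) • t' s - x (k - s) • (t' s * b') := by
  rw [← mul_assoc, H.t_e, avg_mul, map_avg]
  congr 1; funext s
  rw [mul_sub, map_sub, mul_assoc, H.t_b, H.tr_i_b, mul_assoc, H.t_i, ← mul_assoc, ← map_mul,
    H.tr_i_t]

/-- If the trace commutes with the framing generators, the twisted squares of `h` are
symmetric. -/
lemma tr_h_e_h_comm (H : BraidTrace q z x y i tr t b t' b' h)
    (hcomm : ∀ X s, tr (X * t s) = tr (t s * X)) (w : A) :
    tr (h * i w * (eAvg i t' t * h)) = tr (eAvg i t' t * h * i w * h) := by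
  unfold eAvg
  rw [avg_mul, avg_mul, avg_mul, mul_avg, map_avg, map_avg, ← avg_equiv (Equiv.neg (ZMod d))]
  congr 1; funext s
  have h1 : h * i w * (i (t' (-s)) * t (- -s) * h) = i (t' s) * (h * i w * h * t (-s)) := by
    rw [neg_neg, ← H.t_i, mul_assoc (t s), H.t'_h, ← mul_assoc, mul_assoc h, ← H.t_i,
      ← mul_assoc h, ← H.t'_h]
    simp only [mul_assoc]
  rw [Equiv.neg_apply, h1, H.tr_left, hcomm, ← H.tr_left]
  simp only [mul_assoc]

end BraidTrace

section Tower

variable {C : Type*} [Ring C] [Algebra K C]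

/-- The elements which commute with `g` under the composite of two relative traces. -/
def traceCommSubmodule (trB : B →ₗ[K] A) (trC : C →ₗ[K] B) (g : C) : Submodule K C :=
  LinearMap.eqLocus (trB ∘ₗ trC ∘ₗ LinearMap.mulRight K g) (trB ∘ₗ trC ∘ₗ LinearMap.mulLeft K g)

lemma mem_traceCommSubmodule {trB : B →ₗ[K] A} {trC : C →ₗ[K] B} {g X : C} :
    X ∈ traceCommSubmodule trB trC g ↔ trB (trC (X * g)) = trB (trC (g * X)) := Iff.rfl

variable {q z : K} {x y : ZMod d → K} {i : A →ₐ[K] B} {trB : B →ₗ[K] A} {t : ZMod d → B} {b : B}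
  {j : B →ₐ[K] C} {trC : C →ₗ[K] B} {T : ZMod d → C} {β g : C}

lemma left_mem_traceComm (HB : LoopTrace x y i trB t b) (HC : LoopTrace x y j trC T β)
    (hg : ∀ a, g * j (i a) = j (i a) * g) (a : A) {X : C}
    (hX : X ∈ traceCommSubmodule trB trC g) : j (i a) * X ∈ traceCommSubmodule trB trC g := by
  rw [mem_traceCommSubmodule] at hX ⊢
  rw [mul_assoc, HC.tr_left, HB.tr_left, hX, ← mul_assoc, hg, mul_assoc, HC.tr_left, HB.tr_left]

lemma right_mem_traceComm (HB : LoopTrace x y i trB t b) (HC : LoopTrace x y j trC T β)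
    (hg : ∀ a, g * j (i a) = j (i a) * g) (a : A) {X : C}
    (hX : X ∈ traceCommSubmodule trB trC g) : X * j (i a) ∈ traceCommSubmodule trB trC g := by
  rw [mem_traceCommSubmodule] at hX ⊢
  rw [mul_assoc, ← hg, ← mul_assoc, HC.tr_right, HB.tr_right, hX, ← mul_assoc, HC.tr_right,
    HB.tr_right]

lemma t_mem_traceComm (HC : BraidTrace q z x y j trC T β t b g)
    (hcomm : ∀ X s, trB (X * t s) = trB (t s * X)) (a : B) (s : ZMod d) :
    j a * T s ∈ traceCommSubmodule trB trC g := by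
  rw [mem_traceCommSubmodule, mul_assoc, ← HC.h_t', ← mul_assoc, HC.tr_h, ← HC.t_i, ← mul_assoc,
    ← HC.t'_h, HC.tr_h, map_smul, map_smul, hcomm]

lemma tr_t_mul_e_sub (HB : LoopTrace x y i trB t b) (HC : BraidTrace q z x y j trC T β t b g)
    (k : ZMod d) : trB (trC (T k * (eAvg j t T * (β - j b)))) = 0 := by
  rw [HC.tr_t_e_b, map_avg]
  simp only [map_sub, map_smul, HB.tr_t, HB.t_b, HB.tr_b, smul_smul, avg_sub]
  rw [← avg_equiv (Equiv.subLeft k) fun s => (y (k - s) * x s) • (1 : A), sub_eq_zero]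
  congr 1; funext s
  simp [mul_comm]

lemma b_t_mem_traceComm (HB : LoopTrace x y i trB t b) (HC : BraidTrace q z x y j trC T β t b g)
    (k m : ZMod d) : j (t k) * (β * T m) ∈ traceCommSubmodule trB trC g := by
  have h1 : j (t k) * (β * T m) * g = j (t k) * g * j (b * t m) := by
    rw [mul_assoc, mul_assoc, ← HC.h_t', ← mul_assoc β, HC.b_h, map_mul]
    simp only [mul_assoc]
  have h2 : g * (j (t k) * (β * T m)) =
      j (b * t m) * g * j (t k) + q • (T (k + m) * (eAvg j t T * (β - j b))) := by
    rw [← mul_assoc, HC.h_t', mul_assoc, HC.h_b_t, mul_add, mul_smul_comm, ← mul_assoc (T k),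
      ← mul_assoc (T k) (T m), ← HC.t_add, HC.t_i, mul_assoc, ← HC.h_t', mul_assoc]
  rw [mem_traceCommSubmodule, h1, h2, map_add, map_add, map_smul trC q, map_smul trB q,
    tr_t_mul_e_sub HB HC, smul_zero, add_zero, HC.tr_h, HC.tr_h, ← mul_assoc, HB.t_b, mul_assoc,
    mul_assoc, HB.t_comm]

lemma b_b_mem_traceComm (HC : BraidTrace q z x y j trC T β t b g)
    (hb : j b * g * j b * g = g * j b * g * j b) (k m : ZMod d) :
    j (b * t k) * (β * T m) ∈ traceCommSubmodule trB trC g := by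
  have h0 : β * g * β = j b * g * j b := by
    apply HC.h_cancel
    rw [HC.b_h, hb, mul_assoc _ β, HC.b_h, ← mul_assoc]
  have h1 : j (b * t k) * (β * T m) * g = j (b * t k) * g * j (b * t m) := by
    rw [mul_assoc, mul_assoc, ← HC.h_t', ← mul_assoc β, HC.b_h, map_mul j b (t m)]
    simp only [mul_assoc]
  have h2 : g * (j (b * t k) * (β * T m)) = j (b * t m) * g * j (t k * b) := by
    rw [← HC.t'_b', map_mul, mul_assoc, ← mul_assoc g, HC.h_t', mul_assoc, ← mul_assoc g,
      ← HC.b_h, ← mul_assoc (β * g), h0, mul_assoc _ (j b), ← HC.t_i, mul_assoc, ← mul_assoc g,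
      ← HC.t'_h]
    rw [← mul_assoc, HC.t_i, mul_assoc, mul_assoc (j (t m)), ← mul_assoc (T k), HC.t_i, mul_assoc,
      ← mul_assoc (T k) g, ← HC.h_t', map_mul]
    simp only [mul_assoc]
  rw [mem_traceCommSubmodule, h1, h2, HC.tr_h, HC.tr_h, HC.t'_b', mul_assoc b,
    mul_assoc b, ← mul_assoc (t k), HC.t'_b', ← mul_assoc (t m), HC.t'_b', mul_assoc b,
    mul_assoc b, HC.t'_comm]

lemma g_mem_traceComm_iff (HC : BraidTrace q z x y j trC T β t b g) (a c : B) :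
    j a * g * j c ∈ traceCommSubmodule trB trC g ↔
      trB (a * trC (g * j c * g)) = trB (trC (g * j a * g) * c) := by
  rw [mem_traceCommSubmodule, ← HC.tr_left, ← HC.tr_right]
  simp only [mul_assoc]

/-- The elements on which `c ↦ trC (g * j c * g)` is given by the generic formula. -/
def genericSubmodule (q z : K) (i : A →ₐ[K] B) (trB : B →ₗ[K] A) (j : B →ₐ[K] C)
    (trC : C →ₗ[K] B) (g : C) : Submodule K B :=
  LinearMap.eqLocus
    (trC ∘ₗ LinearMap.mulRight K g ∘ₗ LinearMap.mulLeft K g ∘ₗ j.toLinearMap)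
    (i.toLinearMap ∘ₗ trB + (q * z) • LinearMap.id)

lemma mem_genericSubmodule {c : B} :
    c ∈ genericSubmodule q z i trB j trC g ↔
      trC (g * j c * g) = i (trB c) + (q * z) • c := Iff.rfl

lemma left_mem_generic (HB : LoopTrace x y i trB t b) (HC : LoopTrace x y j trC T β)
    (hg : ∀ a, g * j (i a) = j (i a) * g) (a : A) {c : B}
    (hc : c ∈ genericSubmodule q z i trB j trC g) :
    i a * c ∈ genericSubmodule q z i trB j trC g := by
  rw [mem_genericSubmodule] at hc ⊢
  rw [map_mul j, ← mul_assoc, hg, mul_assoc, mul_assoc, HC.tr_left, ← mul_assoc, hc, HB.tr_left,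
    map_mul i, mul_add, mul_smul_comm]

lemma right_mem_generic (HB : LoopTrace x y i trB t b) (HC : LoopTrace x y j trC T β)
    (hg : ∀ a, g * j (i a) = j (i a) * g) (a : A) {c : B}
    (hc : c ∈ genericSubmodule q z i trB j trC g) :
    c * i a ∈ genericSubmodule q z i trB j trC g := by
  rw [mem_genericSubmodule] at hc ⊢
  rw [map_mul j, mul_assoc, mul_assoc, ← hg, ← mul_assoc (j c), ← mul_assoc g, HC.tr_right,
    ← mul_assoc g,
    hc, HB.tr_right, map_mul i, add_mul, smul_mul_assoc]

lemma t_mem_generic [CharZero K] (HB : LoopTrace x y i trB t b)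
    (HC : BraidTrace q z x y j trC T β t b g) (k : ZMod d) :
    t k ∈ genericSubmodule q z i trB j trC g := by
  rw [mem_genericSubmodule, HC.tr_h_t'_h, HB.tr_t, map_smul, map_one]

lemma b_mem_generic [CharZero K] (HB : LoopTrace x y i trB t b)
    (HC : BraidTrace q z x y j trC T β t b g) (k : ZMod d) :
    b * t k ∈ genericSubmodule q z i trB j trC g := by
  rw [mem_genericSubmodule, HC.tr_h_b'_h, HB.tr_b, map_smul, map_one]

lemma g_mem_traceComm_of_generic (HB : LoopTrace x y i trB t b)
    (HC : BraidTrace q z x y j trC T β t b g) {a c : B}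
    (ha : a ∈ genericSubmodule q z i trB j trC g) (hc : c ∈ genericSubmodule q z i trB j trC g) :
    j a * g * j c ∈ traceCommSubmodule trB trC g := by
  rw [mem_genericSubmodule] at ha hc
  rw [g_mem_traceComm_iff HC, ha, hc, mul_add, add_mul, map_add, map_add, HB.tr_right, HB.tr_left,
    mul_smul_comm, smul_mul_assoc]

/-- The span of the products `i a * h * i c`. -/
def doubleCoset (i : A →ₐ[K] B) (h : B) : Submodule K B :=
  Submodule.span K (Set.range fun p : A × A => i p.1 * h * i p.2)

lemma mem_doubleCoset (i : A →ₐ[K] B) (h : B) (a c : A) : i a * h * i c ∈ doubleCoset i h :=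
  Submodule.subset_span ⟨(a, c), rfl⟩

lemma doubleCoset_le {i : A →ₐ[K] B} {h : B} {P : Submodule K B}
    (hP : ∀ a c, i a * h * i c ∈ P) : doubleCoset i h ≤ P :=
  Submodule.span_le.2 (by rintro _ ⟨p, rfl⟩; exact hP _ _)

lemma left_mem_doubleCoset {i : A →ₐ[K] B} {h : B} (a : A) {X : B} (hX : X ∈ doubleCoset i h) :
    i a * X ∈ doubleCoset i h := by
  refine (doubleCoset_le (P := (doubleCoset i h).comap (LinearMap.mulLeft K (i a))) ?_) hX
  intro c c'
  simp only [Submodule.mem_comap, LinearMap.mulLeft_apply]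
  rw [← mul_assoc, ← mul_assoc, ← map_mul]
  exact mem_doubleCoset i h _ _

/-- The sum of the three types of elements spanning `B` over `A`. -/
def stepSubmodule (i : A →ₐ[K] B) (t : ZMod d → B) (b h : B) : Submodule K B :=
  Submodule.span K (Set.range fun p : A × ZMod d => i p.1 * t p.2) ⊔
  Submodule.span K (Set.range fun p : A × ZMod d => i p.1 * (b * t p.2)) ⊔ doubleCoset i h

lemma stepSubmodule_le {i : A →ₐ[K] B} {t : ZMod d → B} {b h : B} {P : Submodule K B}
    (h1 : ∀ w k, i w * t k ∈ P) (h2 : ∀ w k, i w * (b * t k) ∈ P)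
    (h3 : ∀ w w', i w * h * i w' ∈ P) : stepSubmodule i t b h ≤ P := by
  refine sup_le (sup_le (Submodule.span_le.2 ?_) (Submodule.span_le.2 ?_)) (doubleCoset_le h3)
  · rintro _ ⟨p, rfl⟩; exact h1 _ _
  · rintro _ ⟨p, rfl⟩; exact h2 _ _

/-- Right-handed version of the spanning property. -/
lemma mem_of_right_span (HB : LoopTrace x y i trB t b) {h : B} (hspan : stepSubmodule i t b h = ⊤)
    (hbr : ∀ c m, i c * (b * t m) - b * t m * i c ∈ doubleCoset i h) {P : Submodule K B}
    (h1 : ∀ w k, t k * i w ∈ P) (h2 : ∀ w k, b * t k * i w ∈ P)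
    (h3 : ∀ w w', i w * h * i w' ∈ P) (X : B) : X ∈ P := by
  refine stepSubmodule_le ?_ ?_ h3 (hspan ▸ Submodule.mem_top : X ∈ stepSubmodule i t b h)
  · intro w k
    rw [← HB.t_i]
    exact h1 w k
  · intro w k
    have := P.add_mem (doubleCoset_le h3 (hbr w k)) (h2 w k)
    rwa [sub_add_cancel] at this

section Braided

variable {t' : ZMod d → A} {b' : A} {h : B}

lemma h_b_t_mem_traceComm (HB : BraidTrace q z x y i trB t b t' b' h)
    (HC : BraidTrace q z x y j trC T β t b g) (hβ : β * j h = j h * β) (m : ZMod d) :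
    j h * (β * T m) ∈ traceCommSubmodule trB trC g := by
  have h1 : j h * (β * T m) * g = j h * g * j (b * t m) := by
    rw [mul_assoc, mul_assoc, ← HC.h_t', ← mul_assoc β, HC.b_h, map_mul]
    simp only [mul_assoc]
  have h2 : g * (j h * (β * T m)) = j (b * t m) * g * j h +
      q • (T m * (eAvg j t T * (β - j b)) * j h) := by
    rw [← mul_assoc (j h), ← hβ, mul_assoc β, ← HC.t_i, ← mul_assoc β, ← mul_assoc g, HC.h_b_t,
      add_mul, smul_mul_assoc]
  have h3 : b * t m * h = t m * h * i b' := by rw [← HB.t_b, mul_assoc, HB.b_h, mul_assoc]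
  have h4 : ∀ s, t s * b * h = t s * h * i b' := fun s => by rw [mul_assoc, HB.b_h, mul_assoc]
  have h5 : ∀ s, trB (t s * h) = z • t' s := fun s => by simpa using HB.tr_t_h s 1
  rw [mem_traceCommSubmodule, h1, h2, HC.tr_h, map_add, HC.tr_h, map_smul trC q, HC.tr_right,
    HC.tr_t_e_b, avg_mul, HB.h_b_t, h3, map_smul, map_add, map_add, map_smul, map_smul, map_smul,
    HB.tr_h_left, HB.tr_t_h, HB.tr_t_e_b, map_avg, HB.t'_b', smul_add, smul_comm z q]
  congr 2
  rw [smul_avg]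
  congr 1; funext s
  rw [sub_mul, map_sub, smul_mul_assoc, smul_mul_assoc, map_smul, map_smul, h4, h5, HB.tr_t_h,
    smul_sub, smul_comm z, smul_comm z]

/-- The trace commutes with the framing generators of the last strand. -/
lemma BraidTrace.tr_comm_t (H : BraidTrace q z x y i trB t b t' b' h)
    (hspan : stepSubmodule i t b h = ⊤) (X : B) (s : ZMod d) :
    trB (X * t s) = trB (t s * X) := by
  have hle : stepSubmodule i t b h ≤ LinearMap.eqLocus (trB ∘ₗ LinearMap.mulRight K (t s))
      (trB ∘ₗ LinearMap.mulLeft K (t s)) := by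
    apply stepSubmodule_le <;> intro w k <;>
      simp only [LinearMap.mem_eqLocus, LinearMap.comp_apply, LinearMap.mulRight_apply,
        LinearMap.mulLeft_apply]
    · rw [mul_assoc, H.t_comm, ← mul_assoc, ← H.t_i, mul_assoc]
    · rw [mul_assoc, mul_assoc b, H.t_comm, ← mul_assoc b, ← H.t_b, mul_assoc (t s), ← mul_assoc,
        ← H.t_i, mul_assoc]
    · rw [mul_assoc, ← H.t_i, ← mul_assoc, mul_assoc (i w), ← H.t'_h, ← mul_assoc, ← mul_assoc,
        ← mul_assoc, H.t_i, mul_assoc (i w) (t s), ← H.h_t', ← map_mul, mul_assoc, mul_assoc,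
        mul_assoc, ← map_mul, H.tr_left, H.tr_left, H.tr_h_right, H.tr_h_right,
        mul_smul_comm, mul_smul_comm, mul_assoc]
  exact hle (hspan ▸ Submodule.mem_top)

lemma tr_h_sq (HC : BraidTrace q z x y j trC T β t b g) (hbraid : g * j h * g = j h * g * j h) :
    trC (g * j h * g) = z • (h * h) := by
  rw [hbraid, HC.tr_h]

lemma generic_h_mem_traceComm (HB : BraidTrace q z x y i trB t b t' b' h)
    (HC : BraidTrace q z x y j trC T β t b g) (hbraid : g * j h * g = j h * g * j h) {a : B}
    (ha : a ∈ genericSubmodule q z i trB j trC g)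
    (hae : trB (a * (eAvg i t' t * h)) = trB (a * h)) :
    j a * g * j h ∈ traceCommSubmodule trB trC g := by
  rw [mem_genericSubmodule] at ha
  rw [g_mem_traceComm_iff HC, tr_h_sq HC hbraid, ha, HB.h_sq, add_mul, map_add, HB.tr_h_left,
    mul_smul_comm, map_smul, mul_add, map_add, mul_one, mul_smul_comm, map_smul, hae,
    smul_mul_assoc, map_smul, smul_add, smul_smul, mul_comm q z]

lemma h_generic_mem_traceComm (HB : BraidTrace q z x y i trB t b t' b' h)
    (HC : BraidTrace q z x y j trC T β t b g) (hbraid : g * j h * g = j h * g * j h) {c : B}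
    (hc : c ∈ genericSubmodule q z i trB j trC g)
    (hce : trB (eAvg i t' t * h * c) = trB (h * c)) :
    j h * g * j c ∈ traceCommSubmodule trB trC g := by
  rw [mem_genericSubmodule] at hc
  rw [g_mem_traceComm_iff HC, tr_h_sq HC hbraid, hc, HB.h_sq, mul_add, map_add, HB.tr_h_right,
    mul_smul_comm, map_smul, smul_mul_assoc, map_smul, add_mul, map_add, one_mul, smul_mul_assoc,
    map_smul, hce, smul_add, smul_smul, mul_comm q z]

lemma h_h_mem_traceComm (HB : BraidTrace q z x y i trB t b t' b' h)
    (HC : BraidTrace q z x y j trC T β t b g) (hg : ∀ a, g * j (i a) = j (i a) * g)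
    (hbraid : g * j h * g = j h * g * j h) (hcomm : ∀ X s, trB (X * t s) = trB (t s * X)) (w : A) :
    j h * g * j (i w * h) ∈ traceCommSubmodule trB trC g := by
  have h1 : trC (g * j (i w * h) * g) = z • (i w * (h * h)) := by
    rw [map_mul j, ← mul_assoc, hg, mul_assoc, mul_assoc, HC.tr_left, ← mul_assoc g,
      tr_h_sq HC hbraid, mul_smul_comm]
  rw [g_mem_traceComm_iff HC, tr_h_sq HC hbraid, h1, mul_smul_comm, smul_mul_assoc, map_smul,
    map_smul, HB.h_sq, mul_add, mul_add, add_mul, map_add, map_add, mul_one, one_mul,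
    HB.tr_h_right, ← mul_assoc, ← mul_assoc, HB.tr_h_left, mul_smul_comm, smul_mul_assoc,
    smul_mul_assoc, map_smul, map_smul, HB.tr_h_e_h_comm hcomm]

lemma tr_e_h_right [CharZero K] (HB : BraidTrace q z x y i trB t b t' b' h) (k : ZMod d) :
    trB (t k * (eAvg i t' t * h)) = trB (t k * h) ∧
      trB (b * t k * (eAvg i t' t * h)) = trB (b * t k * h) := by
  constructor
  · simpa using (HB.tr_t_e_h k 1).trans (HB.tr_t_h k 1).symm
  · have h1 : b * t k * (eAvg i t' t * h) = t k * (eAvg i t' t * h) * i b' := by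
      rw [← HB.t_b, mul_assoc, ← mul_assoc b, ← HB.e_b, mul_assoc _ b, HB.b_h]
      simp only [mul_assoc]
    have h2 : b * t k * h = t k * h * i b' := by rw [← HB.t_b, mul_assoc, HB.b_h, mul_assoc]
    rw [h1, h2, HB.tr_t_e_h, HB.tr_t_h]

lemma tr_e_h_left [CharZero K] (HB : BraidTrace q z x y i trB t b t' b' h) (k : ZMod d) :
    trB (eAvg i t' t * h * t k) = trB (h * t k) ∧
      trB (eAvg i t' t * h * (b * t k)) = trB (h * (b * t k)) := by
  have h1 : ∀ a, trB (i a * (eAvg i t' t * h)) = trB (i a * h) := fun a => by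
    have := (HB.tr_t_e_h 0 1).trans (HB.tr_t_h 0 1).symm
    simp only [HB.t_zero, one_mul, map_one, mul_one] at this
    rw [HB.tr_left, HB.tr_left, this]
  constructor
  · rw [mul_assoc, ← HB.t'_h, ← mul_assoc, HB.e_t', mul_assoc, h1]
  · have h2 : eAvg i t' t * i (b' * t' k) = i (b' * t' k) * eAvg i t' t := by
      rw [map_mul, ← mul_assoc, HB.e_b', mul_assoc, HB.e_t', mul_assoc]
    have h3 : eAvg i t' t * (t k * (eAvg i t' t * (b - i b'))) =
        t k * (eAvg i t' t * (b - i b')) := by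
      rw [← mul_assoc, HB.e_t, mul_assoc, ← mul_assoc (eAvg i t' t), HB.e_e]
    rw [mul_assoc, HB.h_b_t, mul_add, mul_smul_comm, h3, ← mul_assoc, h2, mul_assoc, map_add,
      h1, map_add]

/-- Two-step trace symmetry when `B` is a commutative algebra generated by `b` and `t`. -/
theorem traceComm_of_loop [CharZero K] (HB : LoopTrace x y i trB t b)
    (HC : BraidTrace q z x y j trC T β t b g)
    (hb : j b * g * j b * g = g * j b * g * j b) (hcomm : ∀ X s, trB (X * t s) = trB (t s * X))
    (hspanB : ∀ P : Submodule K B, (∀ k, t k ∈ P) → (∀ k, b * t k ∈ P) → ∀ X, X ∈ P)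
    (hspanC : stepSubmodule j T β g = ⊤) (X : C) :
    trB (trC (X * g)) = trB (trC (g * X)) := by
  rw [← mem_traceCommSubmodule]
  refine stepSubmodule_le ?_ ?_ ?_ (hspanC ▸ Submodule.mem_top : X ∈ stepSubmodule j T β g)
  · exact t_mem_traceComm HC hcomm
  · intro a m
    refine hspanB ((traceCommSubmodule trB trC g).comap
      (LinearMap.mulRight K (β * T m) ∘ₗ j.toLinearMap)) ?_ ?_ a
    · exact fun k => b_t_mem_traceComm HB HC k m
    · exact fun k => b_b_mem_traceComm HC hb k m
  · have hgen : ∀ a, a ∈ genericSubmodule q z i trB j trC g :=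
      hspanB _ (t_mem_generic HB HC) (b_mem_generic HB HC)
    exact fun a c => g_mem_traceComm_of_generic HB HC (hgen a) (hgen c)

/-- Two-step trace symmetry in general. -/
theorem traceComm_of_braid [CharZero K] (HB : BraidTrace q z x y i trB t b t' b' h)
    (HC : BraidTrace q z x y j trC T β t b g) (hg : ∀ a, g * j (i a) = j (i a) * g)
    (hb : j b * g * j b * g = g * j b * g * j b) (hbraid : g * j h * g = j h * g * j h)
    (hβ : β * j h = j h * β)
    (hspanB : stepSubmodule i t b h = ⊤)
    (hbrB : ∀ c m, i c * (b * t m) - b * t m * i c ∈ doubleCoset i h)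
    (hspanC : stepSubmodule j T β g = ⊤)
    (hbrC : ∀ c m, j c * (β * T m) - β * T m * j c ∈ doubleCoset j g) (X : C) :
    trB (trC (X * g)) = trB (trC (g * X)) := by
  have HBl := HB.toLoopTrace
  have HCl := HC.toLoopTrace
  have hcomm := HB.tr_comm_t hspanB
  have left_span : ∀ {P : Submodule K B}, (∀ w k, i w * t k ∈ P) →
      (∀ w k, i w * (b * t k) ∈ P) → (∀ w w', i w * h * i w' ∈ P) → ∀ a, a ∈ P :=
    fun h1 h2 h3 a => stepSubmodule_le h1 h2 h3 (hspanB ▸ Submodule.mem_top)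
  have any_h : ∀ a, j a * g * j h ∈ traceCommSubmodule trB trC g := by
    refine left_span (P := (traceCommSubmodule trB trC g).comap
      (LinearMap.mulRight K (j h) ∘ₗ LinearMap.mulRight K g ∘ₗ j.toLinearMap)) ?_ ?_ ?_
    all_goals
      intro w k
      simp only [Submodule.mem_comap, LinearMap.comp_apply, LinearMap.mulRight_apply,
        AlgHom.toLinearMap_apply, map_mul j]
      try rw [mul_assoc (j (i w)), mul_assoc (j (i w))]
    · exact left_mem_traceComm HBl HCl hg w (generic_h_mem_traceComm HB HC hbraid
        (t_mem_generic HBl HC k) (tr_e_h_right HB k).1)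
    · rw [← map_mul]
      exact left_mem_traceComm HBl HCl hg w (generic_h_mem_traceComm HB HC hbraid
        (b_mem_generic HBl HC k) (tr_e_h_right HB k).2)
    · have := left_mem_traceComm HBl HCl hg w (h_h_mem_traceComm HB HC hg hbraid hcomm k)
      rw [map_mul, ← mul_assoc (j h * g), mul_assoc (j h), hg] at this
      simpa only [mul_assoc] using this
  have any_hw : ∀ a w w', j a * g * j (i w * h * i w') ∈ traceCommSubmodule trB trC g := by
    intro a w w'
    have := right_mem_traceComm HBl HCl hg w' (any_h (a * i w))
    rw [map_mul j, mul_assoc (j a), ← hg] at this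
    simpa only [mul_assoc, map_mul j] using this
  have h_any : ∀ c, j h * g * j c ∈ traceCommSubmodule trB trC g := by
    refine mem_of_right_span HBl hspanB hbrB (P := (traceCommSubmodule trB trC g).comap
      (LinearMap.mulLeft K (j h * g) ∘ₗ j.toLinearMap)) ?_ ?_ ?_
    · intro w k
      have := right_mem_traceComm HBl HCl hg w (h_generic_mem_traceComm HB HC hbraid
        (t_mem_generic HBl HC k) (tr_e_h_left HB k).1)
      rwa [mul_assoc, ← map_mul] at this
    · intro w k
      have := right_mem_traceComm HBl HCl hg w (h_generic_mem_traceComm HB HC hbraid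
        (b_mem_generic HBl HC k) (tr_e_h_left HB k).2)
      rwa [mul_assoc, ← map_mul] at this
    · exact any_hw h
  have g_mem : ∀ a c, j a * g * j c ∈ traceCommSubmodule trB trC g := by
    intro a c
    have gen : ∀ {a}, a ∈ genericSubmodule q z i trB j trC g →
        j a * g * j c ∈ traceCommSubmodule trB trC g := by
      intro a ha
      refine mem_of_right_span HBl hspanB hbrB (P := (traceCommSubmodule trB trC g).comap
        (LinearMap.mulLeft K (j a * g) ∘ₗ j.toLinearMap)) ?_ ?_ ?_ c
      · exact fun w k => g_mem_traceComm_of_generic HBl HC ha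
          (right_mem_generic HBl HCl hg w (t_mem_generic HBl HC k))
      · exact fun w k => g_mem_traceComm_of_generic HBl HC ha
          (right_mem_generic HBl HCl hg w (b_mem_generic HBl HC k))
      · exact any_hw a
    refine left_span (P := (traceCommSubmodule trB trC g).comap
      (LinearMap.mulRight K (j c) ∘ₗ LinearMap.mulRight K g ∘ₗ j.toLinearMap)) ?_ ?_ ?_ a
    · exact fun w k => gen (left_mem_generic HBl HCl hg w (t_mem_generic HBl HC k))
    · exact fun w k => gen (left_mem_generic HBl HCl hg w (b_mem_generic HBl HC k))
    · intro w w'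
      have := left_mem_traceComm HBl HCl hg w (h_any (i w' * c))
      rw [map_mul j, ← mul_assoc (j h * g), mul_assoc (j h), hg] at this
      simpa only [Submodule.mem_comap, LinearMap.comp_apply, LinearMap.mulRight_apply,
        AlgHom.toLinearMap_apply, map_mul j, mul_assoc] using this
  have b_mem : ∀ a m, j a * (β * T m) ∈ traceCommSubmodule trB trC g := by
    intro a m
    refine left_span (P := (traceCommSubmodule trB trC g).comap
      (LinearMap.mulRight K (β * T m) ∘ₗ j.toLinearMap)) ?_ ?_ ?_ a
    all_goals
      intro w k
      simp only [Submodule.mem_comap, LinearMap.comp_apply, LinearMap.mulRight_apply,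
        AlgHom.toLinearMap_apply, map_mul j]
      rw [mul_assoc]
    · exact left_mem_traceComm HBl HCl hg w (b_t_mem_traceComm HBl HC k m)
    · rw [← map_mul]
      exact left_mem_traceComm HBl HCl hg w (b_b_mem_traceComm HC hb k m)
    · have h1 := right_mem_traceComm HBl HCl hg k (h_b_t_mem_traceComm HB HC hβ m)
      have h2 := doubleCoset_le g_mem (left_mem_doubleCoset h (hbrC (i k) m))
      have h3 := left_mem_traceComm HBl HCl hg w (Submodule.add_mem _ h2 h1)
      rw [mul_sub, mul_assoc (j h) (β * T m), sub_add_cancel] at h3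
      simpa only [mul_assoc] using h3
  rw [← mem_traceCommSubmodule]
  exact stepSubmodule_le (t_mem_traceComm HC hcomm) b_mem g_mem
    (hspanC ▸ Submodule.mem_top : X ∈ stepSubmodule j T β g)

end Braided

end Tower

end RelativeTrace

section Framization

variable {d n : ℕ}

lemma mkY_eq {a b : FA n} (h : YBrel d n a b) : mkY d n a = mkY d n b :=
  RingQuot.mkAlgHom_rel _ h

lemma Gg_of_not {i : ℕ} (h : ¬(1 ≤ i ∧ i ≤ n - 1)) : Gg n i = 1 := dif_neg h

lemma Tt_of_not {j : ℕ} (h : ¬(1 ≤ j ∧ j ≤ n)) : Tt n j = 1 := dif_neg h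

lemma gY_of_not {i : ℕ} (h : ¬(1 ≤ i ∧ i ≤ n - 1)) : gY d n i = 1 := by
  simp [gY, Gg_of_not h]

lemma tY_of_not {j : ℕ} (h : ¬(1 ≤ j ∧ j ≤ n)) : tY d n j = 1 := by
  simp [tY, Tt_of_not h]

lemma gY_comm {i j : ℕ} (h : i + 1 < j ∨ j + 1 < i) :
    gY d n i * gY d n j = gY d n j * gY d n i := by
  by_cases hi : 1 ≤ i ∧ i ≤ n - 1
  · by_cases hj : 1 ≤ j ∧ j ≤ n - 1
    · simpa [gY] using mkY_eq (YBrel.gg (d := d) i j hi.1 hi.2 hj.1 hj.2 h)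
    · simp [gY_of_not hj]
  · simp [gY_of_not hi]

lemma gY_braid {i : ℕ} (h1 : 1 ≤ i) (h2 : i ≤ n - 2) :
    gY d n i * gY d n (i + 1) * gY d n i = gY d n (i + 1) * gY d n i * gY d n (i + 1) := by
  simpa [gY] using mkY_eq (YBrel.braid (d := d) i h1 h2)

lemma bY_gY {i : ℕ} (h : i ≠ 1) : bY d n * gY d n i = gY d n i * bY d n := by
  by_cases hi : 2 ≤ i ∧ i ≤ n - 1
  · simpa [gY, bY] using mkY_eq (YBrel.bg (d := d) i hi.1 hi.2)
  · rw [gY_of_not (by omega)]; simp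

lemma bY_gY_bY_gY : bY d n * gY d n 1 * bY d n * gY d n 1 =
    gY d n 1 * bY d n * gY d n 1 * bY d n := by
  simpa [gY, bY] using mkY_eq (YBrel.bgbg (d := d) (n := n))

lemma tY_comm (i j : ℕ) : tY d n i * tY d n j = tY d n j * tY d n i := by
  by_cases hi : 1 ≤ i ∧ i ≤ n
  · by_cases hj : 1 ≤ j ∧ j ≤ n
    · simpa [tY] using mkY_eq (YBrel.tt (d := d) i j hi.1 hi.2 hj.1 hj.2)
    · simp [tY_of_not hj]
  · simp [tY_of_not hi]

lemma tY_gY {i : ℕ} (j : ℕ) (h1 : 1 ≤ i) (h2 : i ≤ n - 1) :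
    tY d n j * gY d n i = gY d n i * tY d n (sAct i j) := by
  by_cases hj : 1 ≤ j ∧ j ≤ n
  · simpa [tY, gY] using mkY_eq (YBrel.tg (d := d) i j h1 h2 hj.1 hj.2)
  · have : sAct i j = j := by
      unfold sAct; rw [if_neg (by omega), if_neg (by omega)]
    rw [this, tY_of_not hj]; simp

lemma tY_bY (i : ℕ) : tY d n i * bY d n = bY d n * tY d n i := by
  by_cases hi : 1 ≤ i ∧ i ≤ n
  · simpa [tY, bY] using mkY_eq (YBrel.tb (d := d) i hi.1 hi.2)
  · simp [tY_of_not hi]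

lemma tY_pow (i : ℕ) : tY d n i ^ d = 1 := by
  by_cases hi : 1 ≤ i ∧ i ≤ n
  · simpa [tY] using mkY_eq (YBrel.td (d := d) i hi.1 hi.2)
  · simp [tY_of_not hi]

lemma gY_mul_self {i : ℕ} (h1 : 1 ≤ i) (h2 : i ≤ n - 1) :
    gY d n i * gY d n i = 1 + (uu - uu⁻¹) • (eY d n i * gY d n i) := by
  simpa [gY, eY, sq] using mkY_eq (YBrel.gsq (d := d) i h1 h2)

lemma bY_mul_self : bY d n * bY d n = 1 + (vv - vv⁻¹) • (fY d n * bY d n) := by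
  simpa [bY, fY, sq] using mkY_eq (YBrel.bsq (d := d) (n := n))

lemma subalgebra_eq_top (S : Subalgebra Kf (YB d n)) (hb : bY d n ∈ S)
    (hg : ∀ i, 1 ≤ i → i ≤ n - 1 → gY d n i ∈ S) (ht : ∀ j, 1 ≤ j → j ≤ n → tY d n j ∈ S)
    (X : YB d n) : X ∈ S := by
  obtain ⟨w, rfl⟩ := RingQuot.mkAlgHom_surjective Kf (YBrel d n) X
  change mkY d n w ∈ S
  induction w using FreeAlgebra.induction with
  | grade0 r => rw [AlgHom.commutes]; exact S.algebraMap_mem r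
  | grade1 a =>
    cases a with
    | b => exact hb
    | g i =>
      have h : 1 ≤ i.val + 1 ∧ i.val + 1 ≤ n - 1 := ⟨by omega, i.2⟩
      have := hg _ h.1 h.2
      rwa [gY, Gg, dif_pos h] at this
    | t j =>
      have h : 1 ≤ j.val + 1 ∧ j.val + 1 ≤ n := ⟨by omega, j.2⟩
      have := ht _ h.1 h.2
      rwa [tY, Tt, dif_pos h] at this
  | mul a b ha hb => rw [map_mul]; exact S.mul_mem ha hb
  | add a b ha hb => rw [map_add]; exact S.add_mem ha hb

/-- The power of `t_j` with exponent in `ℤ/d`. -/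
def tP (d n j : ℕ) (s : ZMod d) : YB d n := tY d n j ^ s.val

lemma tP_of_commute {j k : ℕ} {X : YB d n} (h : tY d n j * X = X * tY d n k) (s : ZMod d) :
    tP d n j s * X = X * tP d n k s :=
  ((show SemiconjBy X (tY d n k) (tY d n j) from h.symm).pow_right s.val).eq.symm

section

variable [NeZero d]

lemma sum_range_eq_sum_zmod {M : Type*} [AddCommMonoid M] (F : ℕ → M) :
    ∑ m ∈ Finset.range d, F m = ∑ s : ZMod d, F s.val := by
  obtain ⟨k, rfl⟩ := Nat.exists_eq_succ_of_ne_zero (NeZero.ne d)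
  exact Finset.sum_range F

lemma tY_pow_mod (j m : ℕ) : tY d n j ^ (m % d) = tY d n j ^ m := by
  conv_rhs => rw [← Nat.div_add_mod m d, pow_add, pow_mul, tY_pow, one_pow, one_mul]

lemma tP_natCast (j m : ℕ) : tP d n j (m : ZMod d) = tY d n j ^ m := by
  rw [tP, ZMod.val_natCast, tY_pow_mod]

lemma tP_zero (j : ℕ) : tP d n j 0 = 1 := by simp [tP]

lemma tP_add (j : ℕ) (r s : ZMod d) : tP d n j (r + s) = tP d n j r * tP d n j s := by
  rw [tP, ZMod.val_add, tY_pow_mod, pow_add]; rfl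

lemma tP_neg_val (j : ℕ) (s : ZMod d) : tY d n j ^ (d - s.val) = tP d n j (-s) := by
  rw [← tP_natCast, Nat.cast_sub s.val_lt.le]; simp

lemma eY_eq (i : ℕ) :
    eY d n i = avg Kf fun s : ZMod d => tP d n i s * tP d n (i + 1) (-s) := by
  simp only [eY, eF, map_smul, map_sum, map_mul, map_pow, avg,
    sum_range_eq_sum_zmod (fun m => mkY d n (Tt n i) ^ m * mkY d n (Tt n (i + 1)) ^ (d - m))]
  congr 1
  exact Finset.sum_congr rfl fun s _ => by rw [← tP_neg_val]; rfl

lemma fY_eq : fY d n = avg Kf fun s : ZMod d => tP d n 1 s := by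
  simp only [fY, fF, map_smul, map_sum, map_pow, avg,
    sum_range_eq_sum_zmod (fun m => mkY d n (Tt n 1) ^ m)]
  rfl

end

section Monoid

variable {M : Type*} [Monoid M] {g g' h h' b : M}

lemma conj_inv_right (hg : g * g' = 1) (hg' : g' * g = 1) {X Y : M} (H : X * g = g * Y) :
    Y * g' = g' * X := by
  calc Y * g' = g' * (g * Y) * g' := by rw [← mul_assoc g', hg', one_mul]
    _ = g' * X := by rw [← H, mul_assoc, mul_assoc, hg, mul_one]

lemma braid_conj (hg' : g' * g = 1) (hh : h * h' = 1) (H : g * h * g = h * g * h) :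
    g' * h * g = h * g * h' := by
  calc g' * h * g = g' * (h * g * h) * h' := by simp only [mul_assoc, hh, mul_one]
    _ = h * g * h' := by rw [← H]; simp only [← mul_assoc, hg', one_mul]

lemma braid_conj_inv (hg : g * g' = 1) (hg' : g' * g = 1) (hh : h * h' = 1) (hh' : h' * h = 1)
    (H : g * h * g = h * g * h) : h' * g' * h = g * h' * g' := by
  have H1 := braid_conj hg' hh H
  calc h' * g' * h = h' * (g' * h * g) * g' := by simp only [mul_assoc, hg, mul_one]
    _ = g * h' * g' := by rw [H1]; simp only [← mul_assoc, hh', one_mul]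

lemma four_braid_conj (hg : g * g' = 1) (hg' : g' * g = 1) (hh : h * h' = 1) (hh' : h' * h = 1)
    (H : g * h * g = h * g * h) (hb : b * h = h * b) (Hb : b * g * b * g = g * b * g * b) :
    g * b * g' * h * (g * b * g') * h = h * (g * b * g') * h * (g * b * g') := by
  have R1 (c : M) : g' * (h * (g * c)) = h * (g * (h' * c)) := by
    simpa only [mul_assoc] using congrArg (· * c) (braid_conj hg' hh H)
  have R2 : h' * (g' * h) = g * (h' * g') := by
    simpa only [mul_assoc] using braid_conj_inv hg hg' hh hh' H
  have R3 (c : M) : b * (h * c) = h * (b * c) := by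
    simpa only [mul_assoc] using congrArg (· * c) hb
  have R4 (c : M) : h' * (b * c) = b * (h' * c) := by
    simpa only [mul_assoc] using congrArg (· * c) (conj_inv_right hh hh' hb).symm
  have R5 (c : M) : b * (g * (b * (g * c))) = g * (b * (g * (b * c))) := by
    simpa only [mul_assoc] using congrArg (· * c) Hb
  have R6 (c : M) : h * (g * (h * c)) = g * (h * (g * c)) := by
    simpa only [mul_assoc] using congrArg (· * c) H.symm
  simp only [mul_assoc, R1, R2, R3, R4, R5, R6]

lemma loop_comm_braid (hg : g * g' = 1) (hg' : g' * g = 1) (hh : h * h' = 1) (hh' : h' * h = 1)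
    (H : g * h * g = h * g * h) (hb : b * h = h * b) :
    g * (h * (g * b * g') * h') = h * (g * b * g') * h' * g := by
  have R1 : g' * (h' * g) = h * (g' * h') := by
    simpa only [mul_assoc] using braid_conj_inv hh hh' hg hg' H.symm
  have R3 (c : M) : b * (h * c) = h * (b * c) := by
    simpa only [mul_assoc] using congrArg (· * c) hb
  have R6 (c : M) : h * (g * (h * c)) = g * (h * (g * c)) := by
    simpa only [mul_assoc] using congrArg (· * c) H.symm
  simp only [mul_assoc, R1, R3, R6]

end Monoid

lemma sAct_left (i : ℕ) : sAct i i = i + 1 := by simp [sAct]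

lemma sAct_right (i : ℕ) : sAct i (i + 1) = i := by simp [sAct]

lemma sAct_of_ne {i j : ℕ} (h1 : j ≠ i) (h2 : j ≠ i + 1) : sAct i j = j := by
  simp [sAct, h1, h2]

section

variable [NeZero d]

lemma eY_gY {i : ℕ} (h1 : 1 ≤ i) (h2 : i ≤ n - 1) :
    eY d n i * gY d n i = gY d n i * eY d n i := by
  have ht (j : ℕ) (s : ZMod d) := tP_of_commute (tY_gY j h1 h2) s
  rw [eY_eq, avg_mul, mul_avg, ← avg_equiv (Equiv.neg (ZMod d))]
  congr 1; funext s
  have hc : tP d n i s * tP d n (i + 1) (-s) = tP d n (i + 1) (-s) * tP d n i s :=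
    ((show Commute _ _ from tY_comm i (i + 1)).pow_pow _ _).eq
  simp only [Equiv.neg_apply, neg_neg]
  rw [mul_assoc, ht, sAct_right, ← mul_assoc, ht, sAct_left, mul_assoc, hc]

lemma gY_mul_gInv {i : ℕ} (h1 : 1 ≤ i) (h2 : i ≤ n - 1) : gY d n i * gInv d n i = 1 := by
  rw [gInv, mul_sub, gY_mul_self h1 h2, mul_smul_comm, eY_gY h1 h2, add_sub_cancel_right]

lemma gInv_mul_gY {i : ℕ} (h1 : 1 ≤ i) (h2 : i ≤ n - 1) : gInv d n i * gY d n i = 1 := by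
  rw [gInv, sub_mul, gY_mul_self h1 h2, smul_mul_assoc, add_sub_cancel_right]

lemma bk_succ {k : ℕ} (hk : 1 ≤ k) : bk d n (k + 1) = gY d n k * bk d n k * gInv d n k := by
  obtain ⟨k, rfl⟩ := Nat.exists_eq_add_of_le' hk
  rfl

lemma bk_succ_gY {k : ℕ} (h1 : 1 ≤ k) (h2 : k ≤ n - 1) :
    bk d n (k + 1) * gY d n k = gY d n k * bk d n k := by
  rw [bk_succ h1, mul_assoc, gInv_mul_gY h1 h2, mul_one]

lemma tY_bk {k : ℕ} (j : ℕ) (h1 : 1 ≤ k) (h2 : k ≤ n) :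
    tY d n j * bk d n k = bk d n k * tY d n j := by
  induction k, h1 using Nat.le_induction generalizing j with
  | base => exact tY_bY j
  | succ k h1 ih =>
    have h3 : k ≤ n - 1 := by omega
    have ht := conj_inv_right (gY_mul_gInv (d := d) h1 h3) (gInv_mul_gY h1 h3)
      (tY_gY (d := d) j h1 h3)
    rw [bk_succ h1, ← mul_assoc, ← mul_assoc, tY_gY j h1 h3, mul_assoc (gY d n k), ih _ (by omega),
      mul_assoc, mul_assoc, ht]
    simp only [mul_assoc]

lemma gY_bk_of_lt {i k : ℕ} (h1 : 1 ≤ k) (h2 : k < i) (h3 : i ≤ n - 1) :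
    gY d n i * bk d n k = bk d n k * gY d n i := by
  induction k, h1 using Nat.le_induction with
  | base => exact (bY_gY (by omega)).symm
  | succ k h1 ih =>
    have h4 : k ≤ n - 1 := by omega
    have hg := gY_comm (d := d) (n := n) (i := i) (j := k) (by omega)
    have hg' := conj_inv_right (gY_mul_gInv (d := d) h1 h4) (gInv_mul_gY h1 h4) hg
    rw [bk_succ h1, ← mul_assoc, ← mul_assoc, hg, mul_assoc (gY d n k), ih (by omega),
      mul_assoc, mul_assoc, hg']
    simp only [mul_assoc]

lemma gY_bk_of_gt {i k : ℕ} (h1 : 1 ≤ i) (h2 : i + 2 ≤ k) (h3 : k ≤ n) :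
    gY d n i * bk d n k = bk d n k * gY d n i := by
  induction k, h2 using Nat.le_induction with
  | base =>
    rw [bk_succ (by omega), bk_succ h1]
    have h4 : i ≤ n - 1 := by omega
    have h5 : i + 1 ≤ n - 1 := by omega
    exact loop_comm_braid (gY_mul_gInv h1 h4) (gInv_mul_gY h1 h4) (gY_mul_gInv (by omega) h5)
      (gInv_mul_gY (by omega) h5) (gY_braid h1 (by omega)) (gY_bk_of_lt h1 (by omega) h5).symm
  | succ k h2 ih =>
    have h4 : k ≤ n - 1 := by omega
    have h1 : 1 ≤ k := by omega
    have hg := gY_comm (d := d) (n := n) (i := i) (j := k) (by omega)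
    have hg' := conj_inv_right (gY_mul_gInv (d := d) h1 h4) (gInv_mul_gY h1 h4) hg
    rw [bk_succ h1, ← mul_assoc, ← mul_assoc, hg, mul_assoc (gY d n k), ih (by omega),
      mul_assoc, mul_assoc, hg']
    simp only [mul_assoc]

lemma bk_gY_bk_gY {k : ℕ} (h1 : 1 ≤ k) (h2 : k ≤ n - 1) :
    bk d n k * gY d n k * bk d n k * gY d n k = gY d n k * bk d n k * gY d n k * bk d n k := by
  induction k, h1 using Nat.le_induction with
  | base => exact bY_gY_bY_gY
  | succ k h1 ih =>
    have h3 : k ≤ n - 1 := by omega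
    rw [bk_succ h1]
    exact four_braid_conj (gY_mul_gInv h1 h3) (gInv_mul_gY h1 h3) (gY_mul_gInv (by omega) h2)
      (gInv_mul_gY (by omega) h2) (gY_braid h1 (by omega)) (gY_bk_of_lt h1 (by omega) h2).symm
      (ih h3)

end

lemma gRange_self (k : ℕ) : gRange d n k k = 1 := by simp [gRange]

lemma gRange_succ {j k : ℕ} (h : j ≤ k) :
    gRange d n j (k + 1) = gY d n k * gRange d n j k := by
  simp [gRange, Nat.succ_sub h, List.range'_1_concat, Nat.add_sub_cancel' h]

lemma exists_of_mem_Mset {k : ℕ} (hk : 1 ≤ k) {X : YB d n} (hkn : k ≤ n) [NeZero d]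
    (hX : X ∈ Mset d n k) : ∃ j m, 1 ≤ j ∧ j ≤ k ∧ m ≤ d - 1 ∧
      (X = gRange d n j k * tY d n j ^ m ∨ X = gRange d n j k * (bk d n j * tY d n j ^ m)) := by
  have ht (j m : ℕ) (h1 : 1 ≤ j) (h2 : j ≤ n) :
      tY d n j ^ m * bk d n j = bk d n j * tY d n j ^ m :=
    ((show Commute _ _ from tY_bk j h1 h2).pow_left m).eq
  induction k, hk using Nat.le_induction generalizing X with
  | base =>
    obtain ⟨m, hm, rfl | rfl⟩ := hX
    · exact ⟨1, m, le_rfl, le_rfl, hm, .inl (by simp [gRange_self])⟩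
    · exact ⟨1, m, le_rfl, le_rfl, hm, .inr (by
        rw [gRange_self, one_mul]; exact ht 1 m le_rfl hkn)⟩
  | succ k hk ih =>
    obtain ⟨k, rfl⟩ := Nat.exists_eq_add_of_le' hk
    obtain ⟨m, hm, rfl | rfl⟩ | ⟨X, hX, rfl⟩ := hX
    · exact ⟨k + 2, m, by omega, le_rfl, hm, .inl (by simp [gRange_self])⟩
    · exact ⟨k + 2, m, by omega, le_rfl, hm, .inr (by
        rw [gRange_self, one_mul]; exact ht _ m (by omega) hkn)⟩
    · obtain ⟨j, m, h1, h2, hm, rfl | rfl⟩ := ih (by omega) hX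
      · exact ⟨j, m, h1, by omega, hm, .inl (by rw [gRange_succ h2, mul_assoc])⟩
      · exact ⟨j, m, h1, by omega, hm, .inr (by rw [gRange_succ h2, mul_assoc])⟩

lemma gY_comm_of_mem_Mset {k i : ℕ} (hk : 1 ≤ k) (hki : k < i) (hi : i ≤ n - 1) [NeZero d]
    {X : YB d n} (hX : X ∈ Mset d n k) : gY d n i * X = X * gY d n i := by
  have ht {j : ℕ} (m : ℕ) (h : j < i) : Commute (gY d n i) (tY d n j ^ m) := by
    refine Commute.pow_right ?_ m
    have := tY_gY (d := d) (n := n) j (i := i) (by omega) hi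
    rw [sAct_of_ne (by omega) (by omega)] at this
    exact this.symm
  have hg {j l : ℕ} (h1 : 1 ≤ j) (h : l ≤ i - 1) : Commute (gY d n i) (gRange d n j l) := by
    refine Commute.list_prod_right _ _ fun y hy => ?_
    simp only [List.map_reverse, List.mem_reverse, List.mem_map, List.mem_range'_1] at hy
    obtain ⟨a, ha, rfl⟩ := hy
    exact gY_comm (by omega)
  obtain ⟨j, m, h1, h2, hm, rfl | rfl⟩ := exists_of_mem_Mset hk (by omega) hX
  · exact (hg h1 (by omega)).mul_right (ht m (by omega))
  · exact (hg h1 (by omega)).mul_right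
      ((show Commute _ _ from gY_bk_of_lt h1 (by omega) hi).mul_right (ht m (by omega)))

namespace IsIncl

variable {inc : YB d n →ₐ[Kf] YB d (n + 1)}

lemma map_tP (H : IsIncl d n inc) {j : ℕ} (h1 : 1 ≤ j) (h2 : j ≤ n) (s : ZMod d) :
    inc (tP d n j s) = tP d (n + 1) j s := by
  rw [tP, map_pow, H.2.2 j h1 h2]; rfl

variable [NeZero d]

lemma map_gInv (H : IsIncl d n inc) {i : ℕ} (h1 : 1 ≤ i) (h2 : i ≤ n - 1) :
    inc (gInv d n i) = gInv d (n + 1) i := by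
  have : inc (eY d n i) = eY d (n + 1) i := by
    simp only [eY_eq, avg, map_smul, map_sum, map_mul]
    congr 1
    exact Finset.sum_congr rfl fun s _ => by
      rw [H.map_tP h1 (by omega), H.map_tP (by omega) (by omega)]
  rw [gInv, map_sub, map_smul, H.2.1 i h1 h2, this]; rfl

lemma map_bk (H : IsIncl d n inc) {k : ℕ} (h1 : 1 ≤ k) (h2 : k ≤ n) :
    inc (bk d n k) = bk d (n + 1) k := by
  induction k, h1 using Nat.le_induction with
  | base => exact H.1
  | succ k h1 ih =>
    have h3 : k ≤ n - 1 := by omega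
    rw [bk_succ h1, map_mul, map_mul, H.2.1 k h1 h3, ih (by omega), H.map_gInv h1 h3, bk_succ h1]

lemma map_gRange (H : IsIncl d n inc) {j k : ℕ} (h1 : 1 ≤ j) (h2 : k ≤ n) :
    inc (gRange d n j k) = gRange d (n + 1) j k := by
  rw [gRange, map_list_prod, List.map_map, gRange]
  congr 1
  refine List.map_congr_left fun a ha => ?_
  simp only [List.mem_reverse, List.mem_range'_1] at ha
  exact H.2.1 a (by omega) (by omega)

lemma map_Mset (H : IsIncl d n inc) {k : ℕ} (h1 : 1 ≤ k) (h2 : k ≤ n) {X : YB d n}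
    (hX : X ∈ Mset d n k) : inc X ∈ Mset d (n + 1) k := by
  induction k, h1 using Nat.le_induction generalizing X with
  | base =>
    obtain ⟨m, hm, rfl | rfl⟩ := hX
    · exact ⟨m, hm, .inl (by rw [map_pow, H.2.2 1 le_rfl h2])⟩
    · exact ⟨m, hm, .inr (by rw [map_mul, map_pow, H.2.2 1 le_rfl h2, H.1])⟩
  | succ k hk ih =>
    obtain ⟨k, rfl⟩ := Nat.exists_eq_add_of_le' hk
    obtain ⟨m, hm, rfl | rfl⟩ | ⟨X, hX, rfl⟩ := hX
    · exact .inl ⟨m, hm, .inl (by rw [map_pow, H.2.2 _ (by omega) h2])⟩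
    · exact .inl ⟨m, hm, .inr (by
        rw [map_mul, map_pow, H.2.2 _ (by omega) h2, H.map_bk (by omega) h2])⟩
    · exact .inr ⟨inc X, ih (by omega) hX, by rw [map_mul, H.2.1 _ (by omega) (by omega)]⟩

lemma tP_mul_map (H : IsIncl d n inc) (s : ZMod d) (a : YB d n) :
    tP d (n + 1) (n + 1) s * inc a = inc a * tP d (n + 1) (n + 1) s := by
  have := subalgebra_eq_top
    ((Subalgebra.centralizer Kf {tP d (n + 1) (n + 1) s}).comap inc) ?_ ?_ ?_ a
  · exact Subalgebra.mem_centralizer_iff Kf |>.1 this _ rfl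
  all_goals simp only [Subalgebra.mem_comap, Subalgebra.mem_centralizer_iff,
    Set.mem_singleton_iff, forall_eq]
  · rw [H.1]; exact tP_of_commute (tY_bY _) s
  · intro i h1 h2
    rw [H.2.1 i h1 h2]
    have := tY_gY (d := d) (n := n + 1) (n + 1) h1 (by omega)
    rw [sAct_of_ne (by omega) (by omega)] at this
    exact tP_of_commute this s
  · intro j h1 h2
    rw [H.2.2 j h1 h2]; exact tP_of_commute (tY_comm _ _) s

lemma gY_mul_map_map (H : IsIncl d n inc) {inc' : YB d (n + 1) →ₐ[Kf] YB d (n + 2)}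
    (H' : IsIncl d (n + 1) inc') (hn : 1 ≤ n) (a : YB d n) :
    gY d (n + 2) (n + 1) * inc' (inc a) = inc' (inc a) * gY d (n + 2) (n + 1) := by
  have := subalgebra_eq_top
    ((Subalgebra.centralizer Kf {gY d (n + 2) (n + 1)}).comap (inc'.comp inc)) ?_ ?_ ?_ a
  · exact Subalgebra.mem_centralizer_iff Kf |>.1 this _ rfl
  all_goals simp only [Subalgebra.mem_comap, Subalgebra.mem_centralizer_iff,
    Set.mem_singleton_iff, forall_eq, AlgHom.comp_apply]
  · rw [H.1, H'.1]; exact (bY_gY (by omega)).symm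
  · intro i h1 h2
    rw [H.2.1 i h1 h2, H'.2.1 i h1 (by omega)]
    exact gY_comm (by omega)
  · intro j h1 h2
    rw [H.2.2 j h1 h2, H'.2.2 j h1 (by omega)]
    have := tY_gY (d := d) (n := n + 2) j (i := n + 1) (by omega) (by omega)
    rw [sAct_of_ne (by omega) (by omega)] at this
    exact this.symm

end IsIncl

section BracketSubmodule

variable {K : Type*} [Field K] {A B : Type*} [Ring A] [Algebra K A] [Ring B] [Algebra K B]

lemma avg_mem {d : ℕ} [NeZero d] {P : Submodule K A} {F : ZMod d → A} (h : ∀ s, F s ∈ P) :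
    avg K F ∈ P :=
  P.smul_mem _ (P.sum_mem fun s _ => h s)

/-- The span of the differences `i a * h * i c - i (a * c) * h`. -/
def bracketSubmodule (i : A →ₐ[K] B) (h : B) : Submodule K B :=
  Submodule.span K (Set.range fun p : A × A => i p.1 * h * i p.2 - i (p.1 * p.2) * h)

lemma mem_bracketSubmodule (i : A →ₐ[K] B) (h : B) (a c : A) :
    i a * h * i c - i (a * c) * h ∈ bracketSubmodule i h :=
  Submodule.subset_span ⟨(a, c), rfl⟩

lemma bracketSubmodule_le {i : A →ₐ[K] B} {h : B} {P : Submodule K B}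
    (hP : ∀ a c, i a * h * i c - i (a * c) * h ∈ P) : bracketSubmodule i h ≤ P :=
  Submodule.span_le.2 (by rintro _ ⟨p, rfl⟩; exact hP _ _)

lemma bracketSubmodule_le_doubleCoset (i : A →ₐ[K] B) (h : B) :
    bracketSubmodule i h ≤ doubleCoset i h :=
  bracketSubmodule_le fun a c => (doubleCoset i h).sub_mem (mem_doubleCoset i h a c)
    (by simpa using mem_doubleCoset i h (a * c) 1)

lemma sub_mem_bracketSubmodule (i : A →ₐ[K] B) (h : B) {a c a' c' : A} (e : a * c = a' * c') :
    i a * h * i c - i a' * h * i c' ∈ bracketSubmodule i h := by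
  have := (bracketSubmodule i h).sub_mem (mem_bracketSubmodule i h a c)
    (mem_bracketSubmodule i h a' c')
  rwa [e, sub_sub_sub_cancel_right] at this

lemma left_mem_bracketSubmodule {i : A →ₐ[K] B} {h : B} (a : A) {X : B}
    (hX : X ∈ bracketSubmodule i h) : i a * X ∈ bracketSubmodule i h := by
  refine (bracketSubmodule_le (P := (bracketSubmodule i h).comap (LinearMap.mulLeft K (i a))) ?_) hX
  intro c c'
  simp only [Submodule.mem_comap, LinearMap.mulLeft_apply]
  rw [mul_sub, ← mul_assoc, ← mul_assoc, ← mul_assoc, ← map_mul, ← map_mul, ← mul_assoc]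
  exact mem_bracketSubmodule i h _ _

lemma right_mem_bracketSubmodule {i : A →ₐ[K] B} {h : B} (a : A) {X : B}
    (hX : X ∈ bracketSubmodule i h) : X * i a ∈ bracketSubmodule i h := by
  refine (bracketSubmodule_le (P := (bracketSubmodule i h).comap
    (LinearMap.mulRight K (i a))) ?_) hX
  intro c c'
  simp only [Submodule.mem_comap, LinearMap.mulRight_apply]
  rw [sub_mul, mul_assoc, ← map_mul]
  exact sub_mem_bracketSubmodule i h (mul_assoc c c' a).symm

end BracketSubmodule

section

variable [NeZero d]

lemma tP_comm (i j : ℕ) (r s : ZMod d) : tP d n i r * tP d n j s = tP d n j s * tP d n i r :=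
  ((show Commute _ _ from tY_comm i j).pow_pow _ _).eq

lemma tP_bk {k : ℕ} (j : ℕ) (h1 : 1 ≤ k) (h2 : k ≤ n) (s : ZMod d) :
    tP d n j s * bk d n k = bk d n k * tP d n j s :=
  tP_of_commute (tY_bk j h1 h2) s

lemma tP_gY {i : ℕ} (j : ℕ) (h1 : 1 ≤ i) (h2 : i ≤ n - 1) (s : ZMod d) :
    tP d n j s * gY d n i = gY d n i * tP d n (sAct i j) s :=
  tP_of_commute (tY_gY j h1 h2) s

lemma eY_bY : eY d n 1 * bY d n = bY d n * eY d n 1 := by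
  rw [eY_eq, avg_mul, mul_avg]
  congr 1; funext s
  rw [mul_assoc, tP_of_commute (tY_bY _), ← mul_assoc, tP_of_commute (tY_bY _), mul_assoc]

lemma bY_bk_two_sub : bY d 2 * bk d 2 2 - bk d 2 2 * bY d 2 =
    (uu - uu⁻¹) • (eY d 2 1 * (gY d 2 1 * bY d 2 * bY d 2 - bY d 2 * gY d 2 1 * bY d 2)) := by
  have hg : gY d 2 1 * gInv d 2 1 = 1 := gY_mul_gInv le_rfl le_rfl
  have hg' : gInv d 2 1 * gY d 2 1 = 1 := gInv_mul_gY le_rfl le_rfl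
  have h : bY d 2 * bk d 2 2 = gInv d 2 1 * bY d 2 * gY d 2 1 * bY d 2 := by
    have := conj_inv_right hg hg' (X := bY d 2 * gY d 2 1 * bY d 2)
      (Y := bY d 2 * gY d 2 1 * bY d 2) (by simpa only [mul_assoc] using bY_gY_bY_gY)
    change bY d 2 * (gY d 2 1 * bY d 2 * gInv d 2 1) = _
    simpa only [mul_assoc] using this
  have h' : bk d 2 2 * bY d 2 = gY d 2 1 * bY d 2 * gInv d 2 1 * bY d 2 := rfl
  have he : gY d 2 1 * bY d 2 * eY d 2 1 = eY d 2 1 * gY d 2 1 * bY d 2 := by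
    rw [mul_assoc, ← eY_bY, ← mul_assoc, ← eY_gY le_rfl le_rfl]
  rw [h, h', gInv]
  simp only [sub_mul, mul_sub, smul_mul_assoc, mul_smul_comm, he, ← mul_assoc, smul_sub]
  abel

lemma bY_bk_two_mem {inc : YB d 1 →ₐ[Kf] YB d 2} (H : IsIncl d 1 inc) (s : ZMod d) :
    (bY d 2 * bk d 2 2 - bk d 2 2 * bY d 2) * tP d 2 2 s ∈ bracketSubmodule inc (gY d 2 1) := by
  have hT := fun (m : ZMod d) => tP_of_commute (tY_bY (d := d) (n := 2) 2) m
  have hT' := fun (m : ZMod d) => tP_of_commute (tY_bY (d := d) (n := 2) 1) m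
  have hTg := fun (m : ZMod d) => tP_gY (d := d) (n := 2) 2 le_rfl le_rfl m
  have htg := fun (m : ZMod d) => tP_gY (d := d) (n := 2) 1 le_rfl le_rfl m
  simp only [sAct_left, show sAct 1 2 = 1 from sAct_right 1] at hTg htg
  rw [bY_bk_two_sub, smul_mul_assoc]
  refine Submodule.smul_mem _ _ ?_
  rw [eY_eq, avg_mul, avg_mul]
  refine avg_mem fun m => ?_
  have h1 : tP d 2 1 m * tP d 2 2 (-m) * (gY d 2 1 * bY d 2 * bY d 2) * tP d 2 2 s =
      inc (tP d 1 1 (m + s)) * gY d 2 1 * inc (tP d 1 1 (-m) * bY d 1 * bY d 1) := by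
    rw [map_mul, map_mul, H.1, H.map_tP le_rfl le_rfl, H.map_tP le_rfl le_rfl, tP_add]
    calc _ = tP d 2 1 m * (tP d 2 2 (-m) * gY d 2 1) * (bY d 2 * (bY d 2 * tP d 2 2 s)) := by
            simp only [mul_assoc]
      _ = tP d 2 1 m * gY d 2 1 * (tP d 2 1 (-m) * tP d 2 2 s) * (bY d 2 * bY d 2) := by
            rw [hTg, ← hT, ← mul_assoc (bY d 2), ← hT]; simp only [mul_assoc]
      _ = tP d 2 1 m * (gY d 2 1 * tP d 2 2 s) * tP d 2 1 (-m) * (bY d 2 * bY d 2) := by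
            rw [tP_comm 1 2]; simp only [mul_assoc]
      _ = _ := by rw [← htg]; simp only [mul_assoc]
  have h2 : tP d 2 1 m * tP d 2 2 (-m) * (bY d 2 * gY d 2 1 * bY d 2) * tP d 2 2 s =
      inc (tP d 1 1 (m + s) * bY d 1) * gY d 2 1 * inc (tP d 1 1 (-m) * bY d 1) := by
    rw [map_mul, map_mul, H.1, H.map_tP le_rfl le_rfl, H.map_tP le_rfl le_rfl, tP_add]
    calc _ = tP d 2 1 m * (tP d 2 2 (-m) * bY d 2) * gY d 2 1 * (bY d 2 * tP d 2 2 s) := by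
            simp only [mul_assoc]
      _ = tP d 2 1 m * bY d 2 * (tP d 2 2 (-m) * gY d 2 1) * tP d 2 2 s * bY d 2 := by
            rw [hT (-m), ← hT s]; simp only [mul_assoc]
      _ = tP d 2 1 m * bY d 2 * gY d 2 1 * (tP d 2 1 (-m) * tP d 2 2 s) * bY d 2 := by
            rw [hTg]; simp only [mul_assoc]
      _ = tP d 2 1 m * bY d 2 * (gY d 2 1 * tP d 2 2 s) * tP d 2 1 (-m) * bY d 2 := by
            rw [tP_comm 1 2]; simp only [mul_assoc]
      _ = tP d 2 1 m * (bY d 2 * tP d 2 1 s) * gY d 2 1 * tP d 2 1 (-m) * bY d 2 := by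
            rw [← htg]; simp only [mul_assoc]
      _ = _ := by rw [← hT']; simp only [mul_assoc]
  rw [mul_sub, sub_mul, h1, h2]
  refine sub_mem_bracketSubmodule inc _ ?_
  have := tP_of_commute (tY_bY (d := d) (n := 1) 1) (-m)
  simp only [mul_assoc]
  rw [← mul_assoc (bY d 1) (tP d 1 1 (-m)), ← this, mul_assoc]


lemma conj_mem_bracketSubmodule {k : ℕ} {i : YB d (k + 1) →ₐ[Kf] YB d (k + 2)}
    {j : YB d (k + 2) →ₐ[Kf] YB d (k + 3)} (hi : IsIncl d (k + 1) i) (hj : IsIncl d (k + 2) j)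
    {X : YB d (k + 2)} (hX : X ∈ bracketSubmodule i (gY d (k + 2) (k + 1))) :
    gY d (k + 3) (k + 2) * j X * gInv d (k + 3) (k + 2) ∈
      bracketSubmodule j (gY d (k + 3) (k + 2)) := by
  refine (bracketSubmodule_le (P := (bracketSubmodule j (gY d (k + 3) (k + 2))).comap
    ((LinearMap.mulRight Kf (gInv d (k + 3) (k + 2))).comp
      ((LinearMap.mulLeft Kf (gY d (k + 3) (k + 2))).comp j.toLinearMap))) ?_) hX
  intro a c
  simp only [Submodule.mem_comap, LinearMap.comp_apply, LinearMap.mulRight_apply,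
    LinearMap.mulLeft_apply, AlgHom.toLinearMap_apply]
  have hG : gY d (k + 3) (k + 2) * gInv d (k + 3) (k + 2) = 1 := gY_mul_gInv (by omega) le_rfl
  have hG' : gInv d (k + 3) (k + 2) * gY d (k + 3) (k + 2) = 1 := gInv_mul_gY (by omega) le_rfl
  have hc (a) := hi.gY_mul_map_map hj (by omega) a
  have hc' (a) : j (i a) * gInv d (k + 3) (k + 2) = gInv d (k + 3) (k + 2) * j (i a) :=
    conj_inv_right hG hG' (hc a).symm
  have hg' : gInv d (k + 2) (k + 1) * gY d (k + 2) (k + 1) = 1 := gInv_mul_gY (by omega) le_rfl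
  have hb : gY d (k + 3) (k + 2) * j (gY d (k + 2) (k + 1)) * gInv d (k + 3) (k + 2) =
      j (gInv d (k + 2) (k + 1)) * gY d (k + 3) (k + 2) * j (gY d (k + 2) (k + 1)) := by
    rw [hj.map_gInv (i := k + 1) (by omega) (by omega), hj.2.1 (k + 1) (by omega) (by omega)]
    exact (braid_conj (gInv_mul_gY (by omega) (by omega)) hG
      (gY_braid (n := k + 3) (by omega) (by omega))).symm
  have key (a c) : gY d (k + 3) (k + 2) * (j (i a) * j (gY d (k + 2) (k + 1)) * j (i c)) *
      gInv d (k + 3) (k + 2) = j (i a * gInv d (k + 2) (k + 1)) * gY d (k + 3) (k + 2) *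
        j (gY d (k + 2) (k + 1) * i c) := by
    calc _ = (gY d (k + 3) (k + 2) * j (i a)) * j (gY d (k + 2) (k + 1)) *
          (j (i c) * gInv d (k + 3) (k + 2)) := by simp only [mul_assoc]
      _ = j (i a) * (gY d (k + 3) (k + 2) * j (gY d (k + 2) (k + 1)) * gInv d (k + 3) (k + 2)) *
          j (i c) := by rw [hc, hc']; simp only [mul_assoc]
      _ = _ := by rw [hb, map_mul j, map_mul j]; simp only [mul_assoc]
  have e (a c) : i a * gInv d (k + 2) (k + 1) * (gY d (k + 2) (k + 1) * i c) = i (a * c) := by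
    rw [mul_assoc, ← mul_assoc (gInv _ _ _), hg', one_mul, map_mul]
  have := key (a * c) 1
  rw [map_one, map_one, mul_one] at this
  rw [map_sub, mul_sub, sub_mul, map_mul j (i a * _), map_mul j (i a), key,
    map_mul j (i (a * c)), this]
  exact sub_mem_bracketSubmodule j _ (by rw [← map_one i, e, e, mul_one])

lemma conj_bracket {R : Type*} [Ring R] {b β g g' t t' : R} (h1 : b * g = g * b)
    (h2 : b * g' = g' * b) (h3 : t * g' = g' * t') :
    g * ((b * β - β * b) * t) * g' = (b * (g * β * g') - g * β * g' * b) * t' := by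
  have R1 (c : R) : g * (b * c) = b * (g * c) := by rw [← mul_assoc, ← h1, mul_assoc]
  have R2 (c : R) : b * (g' * c) = g' * (b * c) := by rw [← mul_assoc, h2, mul_assoc]
  simp only [sub_mul, mul_sub, mul_assoc, R1, ← R2, h3]

lemma bracket_mem {inc : (k : ℕ) → (YB d k →ₐ[Kf] YB d (k + 1))}
    (hinc : ∀ k, 1 ≤ k → IsIncl d k (inc k)) (k : ℕ) (c : YB d (k + 1)) (s : ZMod d) :
    inc (k + 1) c * (bk d (k + 2) (k + 2) * tP d (k + 2) (k + 2) s) -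
      bk d (k + 2) (k + 2) * tP d (k + 2) (k + 2) s * inc (k + 1) c ∈
      bracketSubmodule (inc (k + 1)) (gY d (k + 2) (k + 1)) := by
  have key (k : ℕ) (s : ZMod d) : (bY d (k + 2) * bk d (k + 2) (k + 2) -
      bk d (k + 2) (k + 2) * bY d (k + 2)) * tP d (k + 2) (k + 2) s ∈
      bracketSubmodule (inc (k + 1)) (gY d (k + 2) (k + 1)) := by
    induction k with
    | zero => exact bY_bk_two_mem (hinc 1 le_rfl) s
    | succ k ih =>
      have hi := hinc (k + 1) (by omega)
      have hj := hinc (k + 2) (by omega)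
      have hG : gY d (k + 3) (k + 2) * gInv d (k + 3) (k + 2) = 1 := gY_mul_gInv (by omega) le_rfl
      have hG' : gInv d (k + 3) (k + 2) * gY d (k + 3) (k + 2) = 1 := gInv_mul_gY (by omega) le_rfl
      have hbG : bY d (k + 3) * gY d (k + 3) (k + 2) = gY d (k + 3) (k + 2) * bY d (k + 3) :=
        bY_gY (by omega)
      have hbG' := conj_inv_right hG hG' hbG
      have hT : tP d (k + 3) (k + 2) s * gInv d (k + 3) (k + 2) =
          gInv d (k + 3) (k + 2) * tP d (k + 3) (k + 3) s := by
        refine conj_inv_right hG hG' ?_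
        have := tP_gY (d := d) (n := k + 3) (k + 3) (i := k + 2) (by omega) le_rfl s
        rwa [show sAct (k + 2) (k + 3) = k + 2 from sAct_right _] at this
      have hmem := conj_mem_bracketSubmodule hi hj ih
      have : gY d (k + 3) (k + 2) * inc (k + 2) ((bY d (k + 2) * bk d (k + 2) (k + 2) -
          bk d (k + 2) (k + 2) * bY d (k + 2)) * tP d (k + 2) (k + 2) s) *
          gInv d (k + 3) (k + 2) = (bY d (k + 3) * bk d (k + 3) (k + 3) -
            bk d (k + 3) (k + 3) * bY d (k + 3)) * tP d (k + 3) (k + 3) s := by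
        rw [map_mul, map_sub, map_mul, map_mul, hj.1, hj.map_bk (by omega) le_rfl,
          hj.map_tP (by omega) le_rfl, bk_succ (k := k + 2) (by omega)]
        exact conj_bracket hbG hbG' hT
      rw [← this]
      exact hmem
  have hi := hinc (k + 1) (by omega)
  let P := bracketSubmodule (inc (k + 1)) (gY d (k + 2) (k + 1))
  let β := bk d (k + 2) (k + 2)
  let T := tP d (k + 2) (k + 2)
  have hzero {a : YB d (k + 1)} (h : inc (k + 1) a * β = β * inc (k + 1) a) (s : ZMod d) :
      (inc (k + 1) a * β - β * inc (k + 1) a) * T s ∈ P := by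
    rw [h, sub_self, zero_mul]; exact P.zero_mem
  let S : Subalgebra Kf (YB d (k + 1)) :=
    { carrier := {a | ∀ s, (inc (k + 1) a * β - β * inc (k + 1) a) * T s ∈ P}
      mul_mem' := by
        intro a c ha hc s
        have : (inc (k + 1) (a * c) * β - β * inc (k + 1) (a * c)) * T s =
            inc (k + 1) a * ((inc (k + 1) c * β - β * inc (k + 1) c) * T s) +
            (inc (k + 1) a * β - β * inc (k + 1) a) * T s * inc (k + 1) c := by
          rw [mul_assoc _ (T s) (inc (k + 1) c), hi.tP_mul_map s c, map_mul]
          simp only [mul_assoc, sub_mul, mul_sub]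
          abel
        rw [this]
        exact P.add_mem (left_mem_bracketSubmodule a (hc s)) (right_mem_bracketSubmodule c (ha s))
      add_mem' := by
        intro a c ha hc s
        have : (inc (k + 1) (a + c) * β - β * inc (k + 1) (a + c)) * T s =
            (inc (k + 1) a * β - β * inc (k + 1) a) * T s +
            (inc (k + 1) c * β - β * inc (k + 1) c) * T s := by
          rw [map_add, ← add_mul]; congr 1; rw [add_mul, mul_add]; abel
        rw [this]
        exact P.add_mem (ha s) (hc s)
      algebraMap_mem' := by
        intro r
        refine hzero ?_
        rw [AlgHom.commutes]
        exact Algebra.commutes r β }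
  have hS : c ∈ S := by
    refine subalgebra_eq_top S ?_ ?_ ?_ c
    · intro s; rw [hi.1]; exact key k s
    · intro i h1 h2
      refine hzero ?_
      rw [hi.2.1 i h1 h2]
      exact gY_bk_of_gt h1 (by omega) le_rfl
    · intro j h1 h2
      refine hzero ?_
      rw [hi.2.2 j h1 h2]
      exact tY_bk j (by omega) le_rfl
  have := hS s
  rwa [sub_mul, mul_assoc, mul_assoc β, ← hi.tP_mul_map s c, ← mul_assoc β] at this

end

lemma braid_sandwich {M : Type*} [Monoid M] {a c g h : M} (ha : g * a = a * g)
    (hc : g * c = c * g) (H : g * h * g = h * g * h) :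
    g * (a * h * c) * g = a * h * g * (h * c) := by
  calc g * (a * h * c) * g = g * a * h * (c * g) := by simp only [mul_assoc]
    _ = a * (g * h * g) * c := by rw [ha, ← hc]; simp only [mul_assoc]
    _ = a * h * g * (h * c) := by rw [H]; simp only [mul_assoc]

lemma mem_of_right_stable {P : Submodule Kf (YB d n)} (h1 : 1 ∈ P)
    (hb : ∀ X ∈ P, X * bY d n ∈ P) (hg : ∀ i, 1 ≤ i → i ≤ n - 1 → ∀ X ∈ P, X * gY d n i ∈ P)
    (ht : ∀ j, 1 ≤ j → j ≤ n → ∀ X ∈ P, X * tY d n j ∈ P) (X : YB d n) : X ∈ P := by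
  let S : Subalgebra Kf (YB d n) :=
    { carrier := {a | ∀ X ∈ P, X * a ∈ P}
      mul_mem' := fun {a c} ha hc X hX => by rw [← mul_assoc]; exact hc _ (ha X hX)
      add_mem' := fun {a c} ha hc X hX => by rw [mul_add]; exact P.add_mem (ha X hX) (hc X hX)
      algebraMap_mem' := fun r X hX => by
        rw [← Algebra.commutes, ← Algebra.smul_def]; exact P.smul_mem r hX }
  have : X ∈ S := subalgebra_eq_top S hb hg ht X
  simpa using this 1 h1

section

variable [NeZero d]

lemma tY_eq_tP (j : ℕ) : tY d n j = tP d n j 1 := by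
  have := tP_natCast (d := d) (n := n) j 1
  rw [Nat.cast_one, pow_one] at this
  exact this.symm

lemma mem_of_one_strand (P : Submodule Kf (YB d 1)) (h1 : ∀ s, tP d 1 1 s ∈ P)
    (h2 : ∀ s, bY d 1 * tP d 1 1 s ∈ P) (X : YB d 1) : X ∈ P := by
  let Q : Submodule Kf (YB d 1) := Submodule.span Kf (Set.range (tP d 1 1)) ⊔
    Submodule.span Kf (Set.range fun s => bY d 1 * tP d 1 1 s)
  have hQ1 (s) : tP d 1 1 s ∈ Q := Submodule.mem_sup_left (Submodule.subset_span ⟨s, rfl⟩)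
  have hQ2 (s) : bY d 1 * tP d 1 1 s ∈ Q :=
    Submodule.mem_sup_right (Submodule.subset_span ⟨s, rfl⟩)
  have hQ {R : Submodule Kf (YB d 1)} (h1 : ∀ s, tP d 1 1 s ∈ R)
      (h2 : ∀ s, bY d 1 * tP d 1 1 s ∈ R) : Q ≤ R :=
    sup_le (Submodule.span_le.2 (by rintro _ ⟨s, rfl⟩; exact h1 s))
      (Submodule.span_le.2 (by rintro _ ⟨s, rfl⟩; exact h2 s))
  have htb := tP_of_commute (tY_bY (d := d) (n := 1) 1)
  refine hQ h1 h2 (mem_of_right_stable (P := Q) ?_ (fun X hX => ?_) (fun i hi hi' => by omega)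
    (fun j hj hj' X hX => ?_) X)
  · rw [← tP_zero (d := d) (n := 1) 1]; exact hQ1 0
  · refine hQ (R := Q.comap (LinearMap.mulRight Kf (bY d 1))) (fun s => ?_) (fun s => ?_) hX
    · simp only [Submodule.mem_comap, LinearMap.mulRight_apply]
      rw [htb]; exact hQ2 s
    · simp only [Submodule.mem_comap, LinearMap.mulRight_apply]
      rw [mul_assoc, htb, ← mul_assoc, bY_mul_self, add_mul, one_mul, smul_mul_assoc, fY_eq,
        avg_mul, avg_mul]
      refine Q.add_mem (hQ1 s) (Q.smul_mem _ (avg_mem fun m => ?_))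
      rw [htb, mul_assoc, ← tP_add]
      exact hQ2 _
  · obtain rfl : j = 1 := by omega
    rw [tY_eq_tP]
    refine hQ (R := Q.comap (LinearMap.mulRight Kf (tP d 1 1 1))) (fun s => ?_) (fun s => ?_) hX
    · simp only [Submodule.mem_comap, LinearMap.mulRight_apply]
      rw [← tP_add]; exact hQ1 _
    · simp only [Submodule.mem_comap, LinearMap.mulRight_apply]
      rw [mul_assoc, ← tP_add]; exact hQ2 _

namespace IsIncl

variable {k : ℕ} {i : YB d (k + 1) →ₐ[Kf] YB d (k + 2)}

lemma gY_mul_map_tP (H : IsIncl d (k + 1) i) (s : ZMod d) :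
    gY d (k + 2) (k + 1) * i (tP d (k + 1) (k + 1) s) =
      tP d (k + 2) (k + 2) s * gY d (k + 2) (k + 1) := by
  rw [H.map_tP (by omega) le_rfl, tP_gY (n := k + 2) (i := k + 1) (k + 2) (by omega) le_rfl,
    show sAct (k + 1) (k + 2) = k + 1 from sAct_right _]

lemma map_tP_mul_gY (H : IsIncl d (k + 1) i) (s : ZMod d) :
    i (tP d (k + 1) (k + 1) s) * gY d (k + 2) (k + 1) =
      gY d (k + 2) (k + 1) * tP d (k + 2) (k + 2) s := by
  rw [H.map_tP (by omega) le_rfl, tP_gY (n := k + 2) (i := k + 1) (k + 1) (by omega) le_rfl,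
    sAct_left]

lemma bk_mul_gY (H : IsIncl d (k + 1) i) :
    bk d (k + 2) (k + 2) * gY d (k + 2) (k + 1) =
      gY d (k + 2) (k + 1) * i (bk d (k + 1) (k + 1)) := by
  rw [H.map_bk (by omega) le_rfl, bk_succ_gY (n := k + 2) (k := k + 1) (by omega) le_rfl]

lemma eY_eq_eAvg (H : IsIncl d (k + 1) i) :
    eY d (k + 2) (k + 1) = eAvg i (tP d (k + 1) (k + 1)) (tP d (k + 2) (k + 2)) := by
  rw [eY_eq, eAvg]
  congr 1; funext s
  rw [H.map_tP (by omega) le_rfl]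

lemma bk_mul_map_tP (H : IsIncl d (k + 1) i) (s : ZMod d) :
    bk d (k + 2) (k + 2) * i (tP d (k + 1) (k + 1) s) =
      i (tP d (k + 1) (k + 1) s) * bk d (k + 2) (k + 2) := by
  rw [H.map_tP (by omega) le_rfl, tP_bk _ (by omega) le_rfl]

end IsIncl

/-- The span of the standard elements of `Y_{k+2}` over `Y_{k+1}`. -/
abbrev stepY (d k : ℕ) [NeZero d] (i : YB d (k + 1) →ₐ[Kf] YB d (k + 2)) :
    Submodule Kf (YB d (k + 2)) :=
  stepSubmodule i (tP d (k + 2) (k + 2)) (bk d (k + 2) (k + 2)) (gY d (k + 2) (k + 1))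

section Step

variable {k : ℕ} {i : YB d (k + 1) →ₐ[Kf] YB d (k + 2)}

lemma mul_tP_mem_stepY (w : YB d (k + 1)) (s : ZMod d) :
    i w * tP d (k + 2) (k + 2) s ∈ stepY d k i :=
  Submodule.mem_sup_left (Submodule.mem_sup_left (Submodule.subset_span ⟨(w, s), rfl⟩))

lemma mul_bk_mem_stepY (w : YB d (k + 1)) (s : ZMod d) :
    i w * (bk d (k + 2) (k + 2) * tP d (k + 2) (k + 2) s) ∈ stepY d k i :=
  Submodule.mem_sup_left (Submodule.mem_sup_right (Submodule.subset_span ⟨(w, s), rfl⟩))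

lemma mul_gY_mul_mem_stepY (w c : YB d (k + 1)) :
    i w * gY d (k + 2) (k + 1) * i c ∈ stepY d k i :=
  Submodule.mem_sup_right (mem_doubleCoset i (gY d (k + 2) (k + 1)) w c)

lemma left_mem_stepY (a : YB d (k + 1)) {X : YB d (k + 2)} (hX : X ∈ stepY d k i) :
    i a * X ∈ stepY d k i := by
  refine (stepSubmodule_le (P := (stepY d k i).comap (LinearMap.mulLeft Kf (i a)))
    (fun w s => ?_) (fun w s => ?_) (fun w c => ?_)) hX
  all_goals simp only [Submodule.mem_comap, LinearMap.mulLeft_apply, ← mul_assoc, ← map_mul i]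
  · exact mul_tP_mem_stepY _ _
  · rw [mul_assoc (i _)]; exact mul_bk_mem_stepY _ _
  · exact mul_gY_mul_mem_stepY _ _

lemma gY_tP_gY_mem (H : IsIncl d (k + 1) i) (s : ZMod d) :
    gY d (k + 2) (k + 1) * i (tP d (k + 1) (k + 1) s) * gY d (k + 2) (k + 1) ∈ stepY d k i := by
  rw [H.gY_mul_map_tP, mul_assoc, gY_mul_self (i := k + 1) (by omega) le_rfl, mul_add, mul_one,
    mul_smul_comm, H.eY_eq_eAvg, eAvg, avg_mul, mul_avg]
  refine Submodule.add_mem _ (by simpa using mul_tP_mem_stepY (i := i) 1 s)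
    (Submodule.smul_mem _ _ (avg_mem fun m => ?_))
  rw [mul_assoc, ← H.gY_mul_map_tP, ← mul_assoc, H.tP_mul_map, mul_assoc, ← mul_assoc (tP _ _ _ s),
    ← H.gY_mul_map_tP, mul_assoc, ← map_mul, ← mul_assoc]
  exact mul_gY_mul_mem_stepY _ _

lemma gY_bk_tP_gY_mem (H : IsIncl d (k + 1) i) (s : ZMod d) :
    gY d (k + 2) (k + 1) * i (bk d (k + 1) (k + 1) * tP d (k + 1) (k + 1) s) *
      gY d (k + 2) (k + 1) ∈ stepY d k i := by
  rw [map_mul, ← mul_assoc, ← H.bk_mul_gY, mul_assoc, mul_assoc, ← mul_assoc (gY _ _ _),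
    H.gY_mul_map_tP, mul_assoc, gY_mul_self (i := k + 1) (by omega) le_rfl, mul_add, mul_one,
    mul_add,
    mul_smul_comm, mul_smul_comm, H.eY_eq_eAvg, eAvg, avg_mul, mul_avg, mul_avg]
  refine Submodule.add_mem _ (by simpa using mul_bk_mem_stepY (i := i) 1 s)
    (Submodule.smul_mem _ _ (avg_mem fun m => ?_))
  rw [mul_assoc, ← H.gY_mul_map_tP, ← mul_assoc (tP _ _ _ s), H.tP_mul_map, mul_assoc,
    ← mul_assoc (tP _ _ _ s), ← H.gY_mul_map_tP, ← mul_assoc, H.bk_mul_map_tP, mul_assoc,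
    mul_assoc, ← mul_assoc (bk _ _ _), H.bk_mul_gY, mul_assoc, ← map_mul, ← map_mul, ← mul_assoc]
  exact mul_gY_mul_mem_stepY _ _

end Step

variable {inc : (k : ℕ) → (YB d k →ₐ[Kf] YB d (k + 1))}

lemma stepY_eq_top_of_gY_mul_gY (hinc : ∀ k, 1 ≤ k → IsIncl d k (inc k)) (k : ℕ)
    (hg : ∀ c, gY d (k + 2) (k + 1) * inc (k + 1) c * gY d (k + 2) (k + 1) ∈
      stepY d k (inc (k + 1))) : stepY d k (inc (k + 1)) = ⊤ := by
  have H := hinc (k + 1) (by omega)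
  set P := stepY d k (inc (k + 1))
  have hA (c : YB d (k + 1)) (X : YB d (k + 2)) (hX : X ∈ P) : X * inc (k + 1) c ∈ P := by
    refine (stepSubmodule_le (P := P.comap (LinearMap.mulRight Kf (inc (k + 1) c)))
      (fun w s => ?_) (fun w s => ?_) (fun w w' => ?_)) hX
    all_goals simp only [Submodule.mem_comap, LinearMap.mulRight_apply]
    · rw [mul_assoc, H.tP_mul_map, ← mul_assoc, ← map_mul]
      exact mul_tP_mem_stepY _ _
    · have := P.sub_mem (mul_bk_mem_stepY (w * c) s) (left_mem_stepY w (Submodule.mem_sup_right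
        (bracketSubmodule_le_doubleCoset _ _ (bracket_mem hinc k c s))))
      rwa [map_mul, mul_sub, ← mul_assoc (inc (k + 1) w) (inc (k + 1) c), sub_sub_cancel,
        ← mul_assoc] at this
    · rw [mul_assoc, ← map_mul]; exact mul_gY_mul_mem_stepY _ _
  refine Submodule.eq_top_iff'.2 (mem_of_right_stable ?_ ?_ ?_ ?_)
  · simpa [tP_zero] using mul_tP_mem_stepY (i := inc (k + 1)) 1 0
  · rw [← H.1]; exact hA _
  · intro l h1 h2 X hX
    rcases Nat.lt_or_ge k l with h | h
    · obtain rfl : l = k + 1 := by omega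
      refine (stepSubmodule_le (P := P.comap (LinearMap.mulRight Kf (gY d (k + 2) (k + 1))))
        (fun w s => ?_) (fun w s => ?_) (fun w w' => ?_)) hX
      all_goals simp only [Submodule.mem_comap, LinearMap.mulRight_apply]
      · rw [mul_assoc, ← H.gY_mul_map_tP, ← mul_assoc]
        exact mul_gY_mul_mem_stepY _ _
      · rw [mul_assoc, mul_assoc, ← H.gY_mul_map_tP, ← mul_assoc (bk _ _ _), H.bk_mul_gY,
          mul_assoc, ← map_mul, ← mul_assoc]
        exact mul_gY_mul_mem_stepY _ _
      · rw [mul_assoc, mul_assoc, ← mul_assoc (gY _ _ _)]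
        exact left_mem_stepY _ (hg w')
    · rw [← H.2.1 l h1 (by omega)]; exact hA _ X hX
  · intro j h1 h2 X hX
    rcases Nat.lt_or_ge (k + 1) j with h | h
    · obtain rfl : j = k + 2 := by omega
      rw [tY_eq_tP]
      refine (stepSubmodule_le (P := P.comap (LinearMap.mulRight Kf (tP d (k + 2) (k + 2) 1)))
        (fun w s => ?_) (fun w s => ?_) (fun w w' => ?_)) hX
      all_goals simp only [Submodule.mem_comap, LinearMap.mulRight_apply]
      · rw [mul_assoc, ← tP_add]; exact mul_tP_mem_stepY _ _
      · rw [mul_assoc, mul_assoc, ← tP_add]; exact mul_bk_mem_stepY _ _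
      · rw [mul_assoc, ← H.tP_mul_map, ← mul_assoc, mul_assoc (inc _ w), ← H.map_tP_mul_gY,
          ← mul_assoc, ← map_mul]
        exact mul_gY_mul_mem_stepY _ _
    · rw [← H.2.2 j h1 h]; exact hA _ X hX

lemma stepY_eq_top (hinc : ∀ k, 1 ≤ k → IsIncl d k (inc k)) (k : ℕ) :
    stepY d k (inc (k + 1)) = ⊤ := by
  induction k with
  | zero =>
    have H := hinc 1 le_rfl
    refine stepY_eq_top_of_gY_mul_gY hinc 0 fun c => ?_
    exact mem_of_one_strand ((stepY d 0 (inc 1)).comap ((LinearMap.mulRight Kf (gY d 2 1)).comp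
      ((LinearMap.mulLeft Kf (gY d 2 1)).comp (inc 1).toLinearMap)))
      (gY_tP_gY_mem H) (gY_bk_tP_gY_mem H) c
  | succ k ih =>
    have H := hinc (k + 1) (by omega)
    have H' := hinc (k + 2) (by omega)
    have hcomm := H.gY_mul_map_map H' (by omega)
    refine stepY_eq_top_of_gY_mul_gY hinc (k + 1) fun c => ?_
    have hc : c ∈ stepY d k (inc (k + 1)) := ih ▸ Submodule.mem_top
    refine (stepSubmodule_le (P := (stepY d (k + 1) (inc (k + 2))).comap
      ((LinearMap.mulRight Kf (gY d (k + 3) (k + 2))).comp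
      ((LinearMap.mulLeft Kf (gY d (k + 3) (k + 2))).comp (inc (k + 2)).toLinearMap)))
      (fun w s => ?_) (fun w s => ?_) (fun w w' => ?_)) hc
    all_goals
      simp only [Submodule.mem_comap, LinearMap.comp_apply, LinearMap.mulRight_apply,
        LinearMap.mulLeft_apply, AlgHom.toLinearMap_apply, map_mul (inc (k + 2)) (inc (k + 1) w)]
    · rw [← mul_assoc, hcomm, mul_assoc, mul_assoc, ← mul_assoc (gY _ _ _)]
      exact left_mem_stepY _ (gY_tP_gY_mem H' s)
    · rw [← mul_assoc, hcomm, mul_assoc, mul_assoc, ← mul_assoc (gY _ _ _)]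
      exact left_mem_stepY _ (gY_bk_tP_gY_mem H' s)
    · have hb : gY d (k + 3) (k + 2) * inc (k + 2) (gY d (k + 2) (k + 1)) *
          gY d (k + 3) (k + 2) = inc (k + 2) (gY d (k + 2) (k + 1)) * gY d (k + 3) (k + 2) *
          inc (k + 2) (gY d (k + 2) (k + 1)) := by
        rw [H'.2.1 (k + 1) (by omega) (by omega)]
        exact (gY_braid (n := k + 3) (by omega) (by omega)).symm
      have : gY d (k + 3) (k + 2) * inc (k + 2) (inc (k + 1) w * gY d (k + 2) (k + 1) *
          inc (k + 1) w') * gY d (k + 3) (k + 2) =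
          inc (k + 2) (inc (k + 1) w * gY d (k + 2) (k + 1)) * gY d (k + 3) (k + 2) *
          inc (k + 2) (gY d (k + 2) (k + 1) * inc (k + 1) w') := by
        simp only [map_mul (inc (k + 2))]
        exact braid_sandwich (hcomm w) (hcomm w') hb
      rw [this]
      exact mul_gY_mul_mem_stepY _ _

end

section

variable [NeZero d]

lemma mul_mem_Cset {inc : YB d n →ₐ[Kf] YB d (n + 1)} (H : IsIncl d n inc) {w : YB d n}
    (hw : w ∈ Cset d n) {μ : YB d (n + 1)} (hμ : μ ∈ Mset d (n + 1) (n + 1)) :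
    inc w * μ ∈ Cset d (n + 1) := by
  obtain ⟨f, hf, rfl⟩ := hw
  refine ⟨Fin.snoc (α := fun _ => YB d (n + 1)) (fun l => inc (f l)) μ, fun l => ?_, ?_⟩
  · induction l using Fin.lastCases with
    | last => simpa using hμ
    | cast l => simpa using H.map_Mset (by omega) (by omega) (hf l)
  · rw [List.ofFn_succ', List.prod_concat]
    simp only [Fin.snoc_castSucc, Fin.snoc_last]
    rw [map_list_prod, List.map_ofFn]
    rfl

lemma exists_eq_mul_of_mem_Cset {c : YB d (n + 1)} (hc : c ∈ Cset d (n + 1)) :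
    ∃ w, ∃ μ ∈ Mset d (n + 1) (n + 1), c = w * μ ∧
      ∀ inc : YB d (n + 1) →ₐ[Kf] YB d (n + 2), IsIncl d (n + 1) inc →
        gY d (n + 2) (n + 1) * inc w = inc w * gY d (n + 2) (n + 1) := by
  obtain ⟨f, hf, rfl⟩ := hc
  refine ⟨(List.ofFn fun l : Fin n => f l.castSucc).prod, f (Fin.last n), hf (Fin.last n), ?_,
    fun inc H => ?_⟩
  · rw [List.ofFn_succ', List.prod_concat]
  · rw [map_list_prod]
    refine (Commute.list_prod_right _ _ fun y hy => ?_).eq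
    simp only [List.map_ofFn, List.mem_ofFn', Set.mem_range, Function.comp_apply] at hy
    obtain ⟨l, rfl⟩ := hy
    exact gY_comm_of_mem_Mset (by simp) (by simp) le_rfl
      (H.map_Mset (by simp) (by simp) (hf l.castSucc))

variable {inc : (k : ℕ) → (YB d k →ₐ[Kf] YB d (k + 1))}

lemma span_Cset (hinc : ∀ k, 1 ≤ k → IsIncl d k (inc k)) (k : ℕ) :
    Submodule.span Kf (Cset d (k + 1)) = ⊤ := by
  have hlt (s : ZMod d) : s.val ≤ d - 1 := Nat.le_sub_one_of_lt s.val_lt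
  induction k with
  | zero =>
    have h {X : YB d 1} (hX : X ∈ Mset d 1 1) : X ∈ Submodule.span Kf (Cset d 1) :=
      Submodule.subset_span ⟨fun _ => X, fun l => by rwa [Subsingleton.elim l 0], by simp⟩
    refine Submodule.eq_top_iff'.2 (mem_of_one_strand _ (fun s => h ⟨s.val, hlt s, .inl rfl⟩)
      fun s => h ⟨s.val, hlt s, .inr (tP_of_commute (tY_bY 1) s).symm⟩)
  | succ k ih =>
    have H := hinc (k + 1) (by omega)
    have hμ (a : YB d (k + 1)) {μ : YB d (k + 2)} (hμ : μ ∈ Mset d (k + 2) (k + 2)) :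
        inc (k + 1) a * μ ∈ Submodule.span Kf (Cset d (k + 2)) := by
      have ha : a ∈ Submodule.span Kf (Cset d (k + 1)) := ih ▸ Submodule.mem_top
      induction ha using Submodule.span_induction with
      | mem w hw => exact Submodule.subset_span (mul_mem_Cset H hw hμ)
      | zero => rw [map_zero, zero_mul]; exact Submodule.zero_mem _
      | add a c _ _ ha hc => rw [map_add, add_mul]; exact Submodule.add_mem _ ha hc
      | smul r a _ ha => rw [map_smul, smul_mul_assoc]; exact Submodule.smul_mem _ r ha
    rw [eq_top_iff, ← stepY_eq_top hinc k]
    refine stepSubmodule_le (fun w s => hμ w (.inl ⟨s.val, hlt s, .inl rfl⟩))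
      (fun w s => hμ w (.inl ⟨s.val, hlt s, .inr (tP_bk _ (by omega) le_rfl s).symm⟩))
      (fun w c => ?_)
    have hc : c ∈ Submodule.span Kf (Cset d (k + 1)) := ih ▸ Submodule.mem_top
    induction hc using Submodule.span_induction with
    | mem c hc =>
      obtain ⟨v, μ, hμ', rfl, hv⟩ := exists_eq_mul_of_mem_Cset hc
      rw [map_mul, ← mul_assoc, mul_assoc (inc (k + 1) w), hv _ H, ← mul_assoc, ← map_mul,
        mul_assoc]
      exact hμ _ (.inr ⟨_, H.map_Mset (by omega) le_rfl hμ', rfl⟩)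
    | zero => rw [map_zero, mul_zero]; exact Submodule.zero_mem _
    | add a c _ _ ha hc => rw [map_add, mul_add]; exact Submodule.add_mem _ ha hc
    | smul r a _ ha => rw [map_smul, mul_smul_comm]; exact Submodule.smul_mem _ r ha

lemma Cset_induction (hinc : ∀ k, 1 ≤ k → IsIncl d k (inc k)) {k : ℕ} {M : Type*}
    [AddCommGroup M] [Module Kf M] {f g : YB d (k + 1) →ₗ[Kf] M}
    (h : ∀ w ∈ Cset d (k + 1), f w = g w) (X : YB d (k + 1)) : f X = g X :=
  DFunLike.congr_fun (LinearMap.ext_on (span_Cset hinc k) h) X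

namespace IsRelTrace

variable {x y : ZMod d → Kf} {k : ℕ} {tr : YB d (k + 2) →ₗ[Kf] YB d (k + 1)}

lemma map_mul_tP (htr : IsRelTrace d x y (k + 1) (inc (k + 1)) tr)
    (hinc : ∀ k, 1 ≤ k → IsIncl d k (inc k)) (a : YB d (k + 1)) (s : ZMod d) :
    tr (inc (k + 1) a * tP d (k + 2) (k + 2) s) = x s • a := by
  refine Cset_induction hinc (f := tr.comp ((LinearMap.mulRight Kf (tP d (k + 2) (k + 2) s)).comp
    (inc (k + 1)).toLinearMap)) (g := x s • LinearMap.id) (fun w hw => ?_) a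
  have := (htr w hw s.val (Nat.le_sub_one_of_lt s.val_lt)).1
  rwa [ZMod.natCast_zmod_val] at this

lemma map_mul_bk (htr : IsRelTrace d x y (k + 1) (inc (k + 1)) tr)
    (hinc : ∀ k, 1 ≤ k → IsIncl d k (inc k)) (a : YB d (k + 1)) (s : ZMod d) :
    tr (inc (k + 1) a * (bk d (k + 2) (k + 2) * tP d (k + 2) (k + 2) s)) = y s • a := by
  refine Cset_induction hinc (f := tr.comp ((LinearMap.mulRight Kf
    (bk d (k + 2) (k + 2) * tP d (k + 2) (k + 2) s)).comp (inc (k + 1)).toLinearMap))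
    (g := y s • LinearMap.id) (fun w hw => ?_) a
  have := (htr w hw s.val (Nat.le_sub_one_of_lt s.val_lt)).2.1
  rwa [ZMod.natCast_zmod_val] at this

lemma map_mul_gY (htr : IsRelTrace d x y (k + 1) (inc (k + 1)) tr)
    (hinc : ∀ k, 1 ≤ k → IsIncl d k (inc k)) (a c : YB d (k + 1)) :
    tr (inc (k + 1) a * gY d (k + 2) (k + 1) * inc (k + 1) c) = zz • (a * c) := by
  have H := hinc (k + 1) (by omega)
  have key (a : YB d (k + 1)) {μ : YB d (k + 1)} (hμ : μ ∈ Mset d (k + 1) (k + 1)) :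
      tr (inc (k + 1) a * (gY d (k + 2) (k + 1) * inc (k + 1) μ)) = zz • (a * μ) := by
    refine Cset_induction hinc (f := tr.comp ((LinearMap.mulRight Kf
      (gY d (k + 2) (k + 1) * inc (k + 1) μ)).comp (inc (k + 1)).toLinearMap))
      (g := zz • LinearMap.mulRight Kf μ) (fun w hw => ?_) a
    simp only [LinearMap.comp_apply, LinearMap.mulRight_apply, AlgHom.toLinearMap_apply,
      LinearMap.smul_apply]
    obtain ⟨j, m, h1, h2, hm, e⟩ := exists_of_mem_Mset (by omega) le_rfl hμ
    have ht := ((htr w hw m hm).2.2 j h1 h2)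
    have hl : j ≠ k + 2 := by omega
    have hjl : tY d (k + 1) j ^ m * bk d (k + 1) j = bk d (k + 1) j * tY d (k + 1) j ^ m :=
      ((show Commute _ _ from tY_bk j h1 h2).pow_left m).eq
    have e1 : mPlus d (k + 1) (k + 1) j m = gRange d (k + 1) j (k + 1) * tY d (k + 1) j ^ m := by
      unfold mPlus; split_ifs with h
      · rw [h, gRange_self, one_mul]
      · rfl
    have e2 : mMinus d (k + 1) (k + 1) j m =
        gRange d (k + 1) j (k + 1) * (bk d (k + 1) j * tY d (k + 1) j ^ m) := by
      unfold mMinus; split_ifs with h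
      · subst h; rw [gRange_self, one_mul, hjl]
      · rfl
    rw [e1, e2, mPlus, mMinus, if_neg hl, if_neg hl, gRange_succ h2] at ht
    rcases e with rfl | rfl
    · rw [← ht.1, map_mul (inc (k + 1)), map_pow (inc (k + 1)), H.map_gRange h1 le_rfl,
        H.2.2 j h1 h2]
      simp only [mul_assoc]
    · rw [← ht.2, map_mul (inc (k + 1)), map_mul (inc (k + 1)), map_pow (inc (k + 1)),
        H.map_gRange h1 le_rfl, H.2.2 j h1 h2, H.map_bk h1 h2]
      simp only [mul_assoc]
  refine Cset_induction hinc (f := tr.comp ((LinearMap.mulLeft Kf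
    (inc (k + 1) a * gY d (k + 2) (k + 1))).comp (inc (k + 1)).toLinearMap))
    (g := zz • LinearMap.mulLeft Kf a) (fun c hc => ?_) c
  obtain ⟨v, μ, hμ, rfl, hv⟩ := exists_eq_mul_of_mem_Cset hc
  simp only [LinearMap.comp_apply, LinearMap.mulLeft_apply, AlgHom.toLinearMap_apply,
    LinearMap.smul_apply]
  rw [map_mul (inc (k + 1)), ← mul_assoc, mul_assoc (inc (k + 1) a), hv _ H, ← mul_assoc,
    ← map_mul (inc (k + 1)), mul_assoc, key _ hμ, mul_assoc]

lemma map_left (htr : IsRelTrace d x y (k + 1) (inc (k + 1)) tr)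
    (hinc : ∀ k, 1 ≤ k → IsIncl d k (inc k)) (a : YB d (k + 1)) (X : YB d (k + 2)) :
    tr (inc (k + 1) a * X) = a * tr X := by
  have hX : X ∈ stepY d k (inc (k + 1)) := stepY_eq_top hinc k ▸ Submodule.mem_top
  refine (stepSubmodule_le (P := LinearMap.eqLocus
    (tr.comp (LinearMap.mulLeft Kf (inc (k + 1) a))) ((LinearMap.mulLeft Kf a).comp tr))
    (fun w s => ?_) (fun w s => ?_) (fun w c => ?_)) hX
  all_goals
    simp only [LinearMap.mem_eqLocus, LinearMap.comp_apply, LinearMap.mulLeft_apply]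
  · rw [← mul_assoc, ← map_mul (inc (k + 1)), htr.map_mul_tP hinc, htr.map_mul_tP hinc,
      mul_smul_comm]
  · rw [← mul_assoc, ← map_mul (inc (k + 1)), htr.map_mul_bk hinc, htr.map_mul_bk hinc,
      mul_smul_comm]
  · rw [← mul_assoc, ← mul_assoc, ← map_mul (inc (k + 1)), htr.map_mul_gY hinc,
      htr.map_mul_gY hinc, mul_smul_comm, mul_assoc]

lemma map_bracket (htr : IsRelTrace d x y (k + 1) (inc (k + 1)) tr)
    (hinc : ∀ k, 1 ≤ k → IsIncl d k (inc k)) {X : YB d (k + 2)}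
    (hX : X ∈ bracketSubmodule (inc (k + 1)) (gY d (k + 2) (k + 1))) : tr X = 0 := by
  refine LinearMap.mem_ker.1 (bracketSubmodule_le (P := LinearMap.ker tr) (fun a c => ?_) hX)
  have := htr.map_mul_gY hinc (a * c) 1
  rw [map_one, mul_one, mul_one] at this
  rw [LinearMap.mem_ker, map_sub tr, htr.map_mul_gY hinc, this, sub_self]

lemma map_right (htr : IsRelTrace d x y (k + 1) (inc (k + 1)) tr)
    (hinc : ∀ k, 1 ≤ k → IsIncl d k (inc k)) (X : YB d (k + 2)) (a : YB d (k + 1)) :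
    tr (X * inc (k + 1) a) = tr X * a := by
  have H := hinc (k + 1) (by omega)
  have hX : X ∈ stepY d k (inc (k + 1)) := stepY_eq_top hinc k ▸ Submodule.mem_top
  refine (stepSubmodule_le (P := LinearMap.eqLocus
    (tr.comp (LinearMap.mulRight Kf (inc (k + 1) a))) ((LinearMap.mulRight Kf a).comp tr))
    (fun w s => ?_) (fun w s => ?_) (fun w c => ?_)) hX
  all_goals
    simp only [LinearMap.mem_eqLocus, LinearMap.comp_apply, LinearMap.mulRight_apply]
  · rw [mul_assoc, H.tP_mul_map, ← mul_assoc, ← map_mul (inc (k + 1)), htr.map_mul_tP hinc,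
      htr.map_mul_tP hinc, smul_mul_assoc]
  · have := htr.map_bracket hinc (left_mem_bracketSubmodule w (bracket_mem hinc k a s))
    rw [mul_sub, map_sub tr, sub_eq_zero, ← mul_assoc, ← map_mul (inc (k + 1)),
      htr.map_mul_bk hinc] at this
    rw [mul_assoc, ← this, htr.map_mul_bk hinc, smul_mul_assoc]
  · rw [mul_assoc, ← map_mul (inc (k + 1)), htr.map_mul_gY hinc, htr.map_mul_gY hinc,
      smul_mul_assoc, mul_assoc]

lemma braidTrace (htr : IsRelTrace d x y (k + 1) (inc (k + 1)) tr)
    (hinc : ∀ k, 1 ≤ k → IsIncl d k (inc k)) :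
    BraidTrace (uu - uu⁻¹) zz x y (inc (k + 1)) tr (tP d (k + 2) (k + 2)) (bk d (k + 2) (k + 2))
      (tP d (k + 1) (k + 1)) (bk d (k + 1) (k + 1)) (gY d (k + 2) (k + 1)) := by
  have H := hinc (k + 1) (by omega)
  exact
    { t_zero := tP_zero _
      t_add := tP_add _
      t_b := tP_bk _ (by omega) le_rfl
      t_i := H.tP_mul_map
      tr_left := htr.map_left hinc
      tr_right := htr.map_right hinc
      tr_t := fun s => by simpa using htr.map_mul_tP hinc 1 s
      tr_b := fun s => by simpa using htr.map_mul_bk hinc 1 s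
      t'_zero := tP_zero _
      t'_add := tP_add _
      t'_b' := tP_bk _ (by omega) le_rfl
      h_t' := H.gY_mul_map_tP
      t'_h := H.map_tP_mul_gY
      b_h := H.bk_mul_gY
      b_t' := H.bk_mul_map_tP
      h_sq := by rw [← H.eY_eq_eAvg]; exact gY_mul_self (by omega) le_rfl
      h_cancel := fun X Y h => by
        have := congrArg (· * gInv d (k + 2) (k + 1)) h
        simpa only [mul_assoc, gY_mul_gInv (n := k + 2) (i := k + 1) (by omega) le_rfl,
          mul_one] using this
      tr_h := htr.map_mul_gY hinc }

end IsRelTrace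

lemma IsTr1.loopTrace {x y : ZMod d → Kf} {tr1 : YB d 1 →ₗ[Kf] Kf} (htr1 : IsTr1 d x y tr1) :
    LoopTrace x y (Algebra.ofId Kf (YB d 1)) tr1 (tP d 1 1) (bY d 1) where
  t_zero := tP_zero _
  t_add := tP_add _
  t_b := tP_of_commute (tY_bY _)
  t_i s a := (Algebra.commutes a _).symm
  tr_left a X := by rw [Algebra.ofId_apply, ← Algebra.smul_def, map_smul, smul_eq_mul]
  tr_right X a := by
    rw [Algebra.ofId_apply, ← Algebra.commutes, ← Algebra.smul_def, map_smul, smul_eq_mul, mul_comm]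
  tr_t s := by
    have := (htr1 s.val (Nat.le_sub_one_of_lt s.val_lt)).1
    rwa [ZMod.natCast_zmod_val, ← mul_one (x s)] at this
  tr_b s := by
    have := (htr1 s.val (Nat.le_sub_one_of_lt s.val_lt)).2
    rwa [ZMod.natCast_zmod_val, ← mul_one (y s)] at this

end

end Framization

/-- here `tr k` is the relative trace `tr_{k+2} : Y_{d,k+2}^B → Y_{d,k+1}^B`
and `tr1` is `tr_1 : Y_{d,1}^B → L`: for every `n ≥ 2` and `X ∈ Y_{d,n}^B`,
`tr_{n-1}(tr_n(X g_{n-1})) = tr_{n-1}(tr_n(g_{n-1} X))`. -/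
theorem stmt16 (d : ℕ) (hd : 1 ≤ d)
    (x y : ZMod d → Kf) (hx0 : x 0 = 1) (hx : ∀ i, x i ≠ 0) (hy : ∀ i, y i ≠ 0)
    (inc : (k : ℕ) → (YB d k →ₐ[Kf] YB d (k + 1))) (hinc : ∀ k, 1 ≤ k → IsIncl d k (inc k))
    (tr1 : YB d 1 →ₗ[Kf] Kf) (htr1 : IsTr1 d x y tr1)
    (tr : (k : ℕ) → (YB d (k + 2) →ₗ[Kf] YB d (k + 1)))
    (htr : ∀ k, IsRelTrace d x y (k + 1) (inc (k + 1)) (tr k)) :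
    (∀ X : YB d 2, tr1 (tr 0 (X * gY d 2 1)) = tr1 (tr 0 (gY d 2 1 * X))) ∧
    (∀ (k : ℕ) (X : YB d (k + 3)),
      tr k (tr (k + 1) (X * gY d (k + 3) (k + 2))) =
      tr k (tr (k + 1) (gY d (k + 3) (k + 2) * X))) := by
  have : NeZero d := ⟨by omega⟩
  constructor
  · intro X
    have H := hinc 1 le_rfl
    refine traceComm_of_loop htr1.loopTrace ((htr 0).braidTrace hinc) ?_ (fun X s => ?_)
      mem_of_one_strand (stepY_eq_top hinc 0) X
    · rw [H.1]; exact bY_gY_bY_gY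
    · congr 1
      refine LinearMap.mem_eqLocus.1 (mem_of_one_strand (LinearMap.eqLocus
        (LinearMap.mulRight Kf (tP d 1 1 s)) (LinearMap.mulLeft Kf (tP d 1 1 s)))
        (fun r => tP_comm _ _ _ _) (fun r => ?_) X)
      change bY d 1 * tP d 1 1 r * tP d 1 1 s = tP d 1 1 s * (bY d 1 * tP d 1 1 r)
      rw [← mul_assoc, tP_of_commute (tY_bY 1), mul_assoc, mul_assoc, tP_comm]
  · intro k X
    have H := hinc (k + 1) (by omega)
    have H' := hinc (k + 2) (by omega)
    refine traceComm_of_braid ((htr k).braidTrace hinc) ((htr (k + 1)).braidTrace hinc)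
      (H.gY_mul_map_map H' (by omega)) ?_ ?_ ?_ (stepY_eq_top hinc k)
      (fun c m => bracketSubmodule_le_doubleCoset _ _ (bracket_mem hinc k c m))
      (stepY_eq_top hinc (k + 1))
      (fun c m => bracketSubmodule_le_doubleCoset _ _ (bracket_mem hinc (k + 1) c m)) X
    · rw [H'.map_bk (by omega) le_rfl]
      exact bk_gY_bk_gY (n := k + 3) (by omega) le_rfl
    · rw [H'.2.1 (k + 1) (by omega) (by omega)]
      exact (gY_braid (n := k + 3) (by omega) (by omega)).symm
    · rw [H'.2.1 (k + 1) (by omega) (by omega)]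
      exact (gY_bk_of_gt (by omega) le_rfl le_rfl).symm
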